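/- arXiv:2506.13659 — 4 statements merged into one kernel-verified Lean document; each statement's English description precedes it below -/
import Mathlib

section
/- Let G be an antiferromagnetic weighted graph on [n] and let t ≥ 2. Then the G-chromatic function h_{K_t}(x_1,…,x_n; G) is a Lorentzian polynomial. -/
open SimpleGraph

/-- The weight a symmetric matrix `G` puts on an unordered pair of indices. -/
noncomputable def edgeWeight {n : ℕ} (G : Matrix (Fin n) (Fin n) ℝ) (hG : G.IsHermitian) :
    Sym2 (Fin n) → ℝ :=
  Sym2.lift ⟨fun i j => G i j, fun i j => by simpa using hG.apply j i⟩

-- The `G`-chromatic function `h_H(x₁,…,x_n; G) = Σ_φ Π_{uv∈E(H)} G(φu,φv) Π_v x_{φ v}`.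
open scoped Classical in
noncomputable def chromPoly {V : Type} [Fintype V] {n : ℕ} (H : SimpleGraph V)
    (G : Matrix (Fin n) (Fin n) ℝ) (hG : G.IsHermitian) : MvPolynomial (Fin n) ℝ :=
  ∑ φ : V → Fin n,
    MvPolynomial.C (∏ e ∈ H.edgeFinset, edgeWeight G hG (e.map φ)) *
      ∏ v : V, MvPolynomial.X (φ v)

/-- `S ⊆ ℕ^n` is M-convex. -/
def MConvex {n : ℕ} (S : Set (Fin n →₀ ℕ)) : Prop :=
  ∀ a ∈ S, ∀ b ∈ S, ∀ i : Fin n, b i < a i →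
    ∃ j : Fin n, a j < b j ∧ a - Finsupp.single i 1 + Finsupp.single j 1 ∈ S

/-- The Hessian matrix of a polynomial (the constant terms of its second partial
derivatives; for a homogeneous quadratic this is the usual Hessian). -/
noncomputable def polyHessian {n : ℕ} (f : MvPolynomial (Fin n) ℝ) :
    Matrix (Fin n) (Fin n) ℝ :=
  fun i j => MvPolynomial.coeff 0 (MvPolynomial.pderiv i (MvPolynomial.pderiv j f))

/-- A polynomial is Lorentzian of degree `d ≥ 2`: it is homogeneous of degree `d` with
nonnegative coefficients; for `d = 2` its Hessian has nonnegative entries and at most one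
positive eigenvalue; for `d > 2` its support is M-convex and all its partial derivatives are
Lorentzian. -/
def IsLorentzian {n : ℕ} : ℕ → MvPolynomial (Fin n) ℝ → Prop
  | 0, _ => False
  | 1, _ => False
  | 2, f => f.IsHomogeneous 2 ∧ (∀ m, 0 ≤ f.coeff m) ∧
      (∀ i j, 0 ≤ polyHessian f i j) ∧
      ∃ h : (polyHessian f).IsHermitian, {i | 0 < h.eigenvalues i}.Subsingleton
  | (d + 3), f => f.IsHomogeneous (d + 3) ∧ (∀ m, 0 ≤ f.coeff m) ∧
      MConvex (f.support : Set (Fin n →₀ ℕ)) ∧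
      ∀ i : Fin n, IsLorentzian (d + 2) (MvPolynomial.pderiv i f)


section Helpers
open Matrix


lemma quad_diag {n : ℕ} (G : Matrix (Fin n) (Fin n) ℝ) (hG : G.IsHermitian) (x : Fin n → ℝ) :
    x ⬝ᵥ G *ᵥ x = ∑ i, hG.eigenvalues i * ((hG.eigenvectorBasis i).ofLp ⬝ᵥ x) ^ 2 := by
  have hx : x = ∑ i, ((hG.eigenvectorBasis i).ofLp ⬝ᵥ x) • (hG.eigenvectorBasis i).ofLp := by
    have := hG.eigenvectorBasis.sum_repr' (WithLp.toLp 2 x)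
    have h2 := congrArg WithLp.ofLp this
    simp only [WithLp.ofLp_sum, WithLp.ofLp_smul] at h2
    rw [← h2]
    refine Finset.sum_congr rfl fun i _ => ?_
    rw [h2, EuclideanSpace.inner_eq_star_dotProduct]
    simp [dotProduct_comm]
  have h1 : G *ᵥ x = ∑ i, ((hG.eigenvectorBasis i).ofLp ⬝ᵥ x) •
      (hG.eigenvalues i • (hG.eigenvectorBasis i).ofLp) := by
    conv_lhs => rw [hx]
    rw [Matrix.mulVec_sum]
    refine Finset.sum_congr rfl fun i _ => ?_
    rw [Matrix.mulVec_smul, hG.mulVec_eigenvectorBasis]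
  rw [h1, dotProduct_sum]
  refine Finset.sum_congr rfl fun i _ => ?_
  simp only [dotProduct_smul, smul_eq_mul]
  rw [dotProduct_comm x]
  ring

lemma afm_functional {n : ℕ} (G : Matrix (Fin n) (Fin n) ℝ) (hG : G.IsHermitian)
    (h : {i | 0 < hG.eigenvalues i}.Subsingleton) :
    ∃ c : Fin n → ℝ, ∀ x, c ⬝ᵥ x = 0 → x ⬝ᵥ G *ᵥ x ≤ 0 := by
  by_cases h0 : ∃ i, 0 < hG.eigenvalues i
  · obtain ⟨i, hi⟩ := h0
    refine ⟨(hG.eigenvectorBasis i).ofLp, fun x hx => ?_⟩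
    rw [quad_diag G hG]
    refine Finset.sum_nonpos fun j _ => ?_
    by_cases hj : 0 < hG.eigenvalues j
    · rw [h hj hi, hx]; simp
    · exact mul_nonpos_of_nonpos_of_nonneg (not_lt.mp hj) (sq_nonneg _)
  · push Not at h0
    refine ⟨0, fun x _ => ?_⟩
    rw [quad_diag G hG]
    exact Finset.sum_nonpos fun j _ => mul_nonpos_of_nonpos_of_nonneg (h0 j) (sq_nonneg _)

lemma functional_afm {n : ℕ} (G : Matrix (Fin n) (Fin n) ℝ) (hG : G.IsHermitian)
    (c : Fin n → ℝ) (hc : ∀ x, c ⬝ᵥ x = 0 → x ⬝ᵥ G *ᵥ x ≤ 0) :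
    {i | 0 < hG.eigenvalues i}.Subsingleton := by
  intro i hi j hj
  by_contra hij
  simp only [Set.mem_ofPred_eq] at hi hj
  have ho : ∀ a b, (hG.eigenvectorBasis a).ofLp ⬝ᵥ (hG.eigenvectorBasis b).ofLp
      = if a = b then 1 else 0 := by
    intro a b
    have := orthonormal_iff_ite.mp hG.eigenvectorBasis.orthonormal a b
    rw [EuclideanSpace.inner_eq_star_dotProduct] at this
    rw [dotProduct_comm, ← this]; simp
  set u := (hG.eigenvectorBasis i).ofLp with hu
  set v := (hG.eigenvectorBasis j).ofLp with hv
  have key : ∀ p q : ℝ, p * (c ⬝ᵥ u) + q * (c ⬝ᵥ v) = 0 →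
      p ^ 2 * hG.eigenvalues i + q ^ 2 * hG.eigenvalues j ≤ 0 := by
    intro p q hpq
    have := hc (p • u + q • v) (by simpa using hpq)
    rw [Matrix.mulVec_add, Matrix.mulVec_smul, Matrix.mulVec_smul, hu, hv,
      hG.mulVec_eigenvectorBasis, hG.mulVec_eigenvectorBasis] at this
    simp only [dotProduct_add, add_dotProduct, smul_dotProduct, dotProduct_smul, ho, smul_eq_mul,
      if_neg hij, if_neg (Ne.symm hij), if_true] at this
    linarith
  by_cases hcu : c ⬝ᵥ u = 0
  · have := key 1 0 (by simp [hcu]); simp at this; linarith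
  · have := key (c ⬝ᵥ v) (-(c ⬝ᵥ u)) (by ring)
    have h1 : 0 < (-(c ⬝ᵥ u)) ^ 2 := by first | positivity | (rw [neg_sq]; positivity)
    nlinarith [mul_pos h1 hj, mul_nonneg (sq_nonneg (c ⬝ᵥ v)) hi.le]

lemma zero_struct {n : ℕ} (G : Matrix (Fin n) (Fin n) ℝ) (hG : G.IsHermitian)
    (hnn : ∀ i j, 0 ≤ G i j)
    (c : Fin n → ℝ) (hc : ∀ x, c ⬝ᵥ x = 0 → x ⬝ᵥ G *ᵥ x ≤ 0)
    (j p k l : Fin n) (hjp : G j p ≠ 0) (hjk : G j k = 0) (hjl : G j l = 0) : G k l = 0 := by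
  have sym : ∀ a b, G a b = G b a := fun a b => by simpa using hG.apply b a
  by_contra hkl
  have h1 := lt_of_le_of_ne (hnn j p) (Ne.symm hjp)
  have h2 := lt_of_le_of_ne (hnn k l) (Ne.symm hkl)
  -- general quadratic inequality
  have key : ∀ r s q : ℝ, r * (c k + c l) + s * c j + q * c p = 0 →
      r ^ 2 * (G k k + 2 * G k l + G l l) + 2 * r * q * (G k p + G l p)
        + s ^ 2 * G j j + 2 * s * q * G j p + q ^ 2 * G p p ≤ 0 := by
    intro r s q h
    have := hc (r • (Pi.single k 1 + Pi.single l 1) + s • Pi.single j 1 + q • Pi.single p 1)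
      (by simp [dotProduct_add]; linarith)
    simp only [Matrix.mulVec_add, Matrix.mulVec_smul, dotProduct_add, add_dotProduct,
      smul_dotProduct, dotProduct_smul, Matrix.mulVec_single_one, single_one_dotProduct,
      Matrix.col_apply, smul_eq_mul, smul_add] at this
    rw [sym k j, sym l j, sym l k, sym p k, sym p l, sym p j, hjk, hjl] at this
    linarith
  set A := G k k + 2 * G k l + G l l with hA
  have hApos : 0 < A := by have := hnn k k; have := hnn l l; linarith
  set B := G k p + G l p
  set U := c k + c l
  have hU : U ≠ 0 := by
    intro hU
    have := key 1 0 0 (by simp [hU])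
    simp at this; linarith
  have h3 : ∀ s : ℝ, A * (s ^ 2 * G j j + 2 * s * G j p + G p p) ≤ B ^ 2 := by
    intro s
    have h4 := key (-(s * c j + c p)) (U * s) U (by ring)
    have h5 : 0 < U ^ 2 := by first | positivity | (rw [neg_sq]; positivity)
    set V := s * c j + c p
    set C := s ^ 2 * G j j + 2 * s * G j p + G p p with hC
    have h6 : V ^ 2 * A - 2 * V * U * B + U ^ 2 * C ≤ 0 := by rw [hC]; linarith
    by_contra h7
    push Not at h7
    nlinarith [sq_nonneg (V * A - U * B), mul_pos h5 (sub_pos.mpr h7), mul_nonneg hApos.le (neg_nonneg.mpr h6)]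
  have h8 := h3 ((B ^ 2 + 1) / (2 * A * G j p))
  set s := (B ^ 2 + 1) / (2 * A * G j p) with hs
  have h9 : A * (2 * s * G j p) = B ^ 2 + 1 := by rw [hs]; field_simp
  have h10 : 0 ≤ A * (s ^ 2 * G j j) := mul_nonneg hApos.le (mul_nonneg (sq_nonneg _) (hnn _ _))
  have h11 := mul_nonneg hApos.le (hnn p p)
  nlinarith

/-- normalized coefficient -/
noncomputable def wt {n : ℕ} (G : Matrix (Fin n) (Fin n) ℝ) (m : Fin n →₀ ℕ) : ℝ :=
  ∏ i, ∏ j, if i < j then G i j ^ (m i * m j) else if i = j then G i i ^ ((m i).choose 2) else 1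

lemma wt_nonneg {n : ℕ} (G : Matrix (Fin n) (Fin n) ℝ) (hnn : ∀ i j, 0 ≤ G i j)
    (m : Fin n →₀ ℕ) : 0 ≤ wt G m := by
  refine Finset.prod_nonneg fun i _ => Finset.prod_nonneg fun j _ => ?_
  split_ifs
  · exact pow_nonneg (hnn _ _) _
  · exact pow_nonneg (hnn _ _) _
  · norm_num

lemma wt_zero {n : ℕ} (G : Matrix (Fin n) (Fin n) ℝ) : wt G 0 = 1 := by
  simp [wt]

lemma wt_ne_zero {n : ℕ} (G : Matrix (Fin n) (Fin n) ℝ) (sym : ∀ a b, G a b = G b a)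
    (m : Fin n →₀ ℕ) : wt G m ≠ 0 ↔ (∀ i, 2 ≤ m i → G i i ≠ 0) ∧
      ∀ i j, i ≠ j → 1 ≤ m i → 1 ≤ m j → G i j ≠ 0 := by
  simp only [wt, Finset.prod_ne_zero_iff, Finset.mem_univ, true_imp_iff]
  constructor
  · intro h
    have h1 : ∀ i j, i < j → 1 ≤ m i → 1 ≤ m j → G i j ≠ 0 := by
      intro i j hij hi hj h0
      have := h i j
      rw [if_pos hij, h0] at this
      exact this (zero_pow (Nat.mul_ne_zero (by omega) (by omega)))
    refine ⟨fun i hi h0 => ?_, fun i j hij hi hj => ?_⟩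
    · have := h i i
      simp only [lt_irrefl, if_false, if_true, h0] at this
      exact this (zero_pow (Nat.choose_pos hi).ne')
    · rcases lt_or_gt_of_ne hij with h2 | h2
      · exact h1 i j h2 hi hj
      · rw [sym]; exact h1 j i h2 hj hi
  · rintro ⟨h1, h2⟩ i j
    split_ifs with h3 h4
    · by_cases hi : m i = 0
      · simp [hi]
      by_cases hj : m j = 0
      · simp [hj]
      exact pow_ne_zero _ (h2 i j h3.ne (by omega) (by omega))
    · by_cases hi : 2 ≤ m i
      · exact pow_ne_zero _ (h1 i hi)
      · rw [Nat.choose_eq_zero_of_lt (by omega)]; simp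
    · exact one_ne_zero

lemma wt_add_single {n : ℕ} (G : Matrix (Fin n) (Fin n) ℝ) (sym : ∀ a b, G a b = G b a)
    (m : Fin n →₀ ℕ) (i : Fin n) :
    wt G (m + Finsupp.single i 1) = wt G m * ∏ k, G i k ^ m k := by
  have h1 : ∀ a b, (if a < b then G a b ^ ((m + Finsupp.single i 1 : Fin n →₀ ℕ) a * (m + Finsupp.single i 1 : Fin n →₀ ℕ) b)
      else if a = b then G a a ^ (((m + Finsupp.single i 1 : Fin n →₀ ℕ) a).choose 2) else 1)
      = (if a < b then G a b ^ (m a * m b) else if a = b then G a a ^ ((m a).choose 2) else 1)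
        * ((if a = i then (if a ≤ b then G i b ^ m b else 1) else 1)
        * (if b = i then (if a < b then G i a ^ m a else 1) else 1)) := by
    intro a b
    rcases lt_trichotomy a b with h | h | h
    · have hab := h.ne
      simp only [h, if_true, h.le, Finsupp.add_apply, Finsupp.single_apply]
      by_cases ha : i = a
      · subst ha
        simp only [if_true, if_neg hab, if_neg hab.symm]
        ring
      · by_cases hb : i = b
        · subst hb
          simp only [if_true, if_neg hab, if_neg hab.symm]
          rw [sym i a]
          ring
        · simp [ha, hb, Ne.symm ha, Ne.symm hb]
    · subst h
      simp only [lt_irrefl, if_false, if_true, le_refl, Finsupp.add_apply, Finsupp.single_apply]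
      by_cases ha : i = a
      · subst ha
        simp [Nat.choose_succ_succ' (m i) 1, pow_add, mul_comm]
      · simp [ha, Ne.symm ha]
    · simp [h.not_gt, h.ne', h.not_ge]
  unfold wt
  simp only [h1, Finset.prod_mul_distrib]
  congr 1
  have e1 : ∏ a : Fin n, ∏ b : Fin n, (if a = i then (if a ≤ b then G i b ^ m b else 1) else 1)
      = ∏ b, if i ≤ b then G i b ^ m b else 1 := by
    rw [Finset.prod_eq_single i]
    · simp
    · intro a _ ha; simp [ha]
    · simp
  have e2 : ∏ a : Fin n, ∏ b : Fin n, (if b = i then (if a < b then G i a ^ m a else 1) else 1)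
      = ∏ a, if a < i then G i a ^ m a else 1 := by
    refine Finset.prod_congr rfl fun a _ => ?_
    rw [Finset.prod_eq_single i]
    · simp
    · intro b _ hb; simp [hb]
    · simp
  rw [e1, e2, ← Finset.prod_mul_distrib]
  refine Finset.prod_congr rfl fun k _ => ?_
  by_cases hk : i ≤ k
  · simp [hk, hk.not_gt]
  · simp [hk, lt_of_not_ge hk]

lemma exists_pos_of_degree {n : ℕ} (m : Fin n →₀ ℕ) (k : Fin n) (hd : m k < m.degree) :
    ∃ j, j ≠ k ∧ 1 ≤ m j := by
  by_contra h
  push Not at h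
  rw [Finsupp.degree_eq_sum, Finset.sum_eq_single k] at hd
  · omega
  · intro b _ hb; have := h b hb; omega
  · simp

lemma mconvex_wt {n : ℕ} (G : Matrix (Fin n) (Fin n) ℝ) (sym : ∀ a b, G a b = G b a)
    (zs : ∀ j p k l, G j p ≠ 0 → G j k = 0 → G j l = 0 → G k l = 0)
    (t : ℕ) (ht : 2 ≤ t) : MConvex {m : Fin n →₀ ℕ | m.degree = t ∧ wt G m ≠ 0} := by
  rintro a ⟨had, ha⟩ b ⟨hbd, hb⟩ i hi
  rw [wt_ne_zero G sym] at ha hb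
  obtain ⟨ha1, ha2⟩ := ha
  obtain ⟨hb1, hb2⟩ := hb
  -- vertices in the support of `a` are not isolated
  have niso : ∀ (m : Fin n →₀ ℕ), m.degree = t → (∀ i, 2 ≤ m i → G i i ≠ 0) →
      (∀ i j, i ≠ j → 1 ≤ m i → 1 ≤ m j → G i j ≠ 0) → ∀ k, 1 ≤ m k → ∃ p, G k p ≠ 0 := by
    intro m hm h1 h2 k hk
    by_cases hk2 : 2 ≤ m k
    · exact ⟨k, h1 k hk2⟩
    · obtain ⟨j, hj, hj1⟩ := exists_pos_of_degree m k (by omega)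
      exact ⟨j, h2 k j hj.symm hk hj1⟩
  by_contra hcon
  push Not at hcon
  have hbad : ∀ j, a j < b j → ∃ k, k ≠ i ∧ b k < a k ∧ a k = 1 ∧ b j = 1 ∧ a j = 0 ∧ G k j = 0 := by
    intro j hj
    have hji : j ≠ i := by rintro rfl; omega
    have hnot := hcon j hj
    set a' : Fin n →₀ ℕ := a - Finsupp.single i 1 + Finsupp.single j 1 with ha'
    have happ : ∀ x, a' x = a x - (if i = x then 1 else 0) + (if j = x then 1 else 0) := by
      intro x; simp [ha', Finsupp.single_apply]
    clear_value a'
    have hdeg : a'.degree = t := by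
      have h : a' + Finsupp.single i 1 = a + Finsupp.single j 1 := by
        ext x
        rw [Finsupp.add_apply, Finsupp.add_apply, happ]
        simp only [Finsupp.single_apply]
        split_ifs with h1 h2 h2
        · subst h1; omega
        · subst h1; omega
        · omega
        · omega
      have := congrArg Finsupp.degree h
      simp [map_add] at this
      omega
    have hw : wt G a' = 0 := by
      by_contra hw; exact hnot ⟨hdeg, hw⟩
    have hw' := mt (wt_ne_zero G sym a').mpr (not_not.mpr hw)
    -- find k
    have hk : ∃ k, k ≠ j ∧ 1 ≤ a' k ∧ G k j = 0 := by
      by_contra hno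
      push Not at hno
      refine hw' ⟨fun x hx => ?_, fun x y hxy hx hy => ?_⟩
      · rw [happ] at hx
        by_cases hxj : j = x
        · subst hxj
          simp [Ne.symm hji] at hx
          exact hb1 j (by omega)
        · simp [hxj] at hx
          exact ha1 x (by omega)
      · by_cases hxj : x = j
        · subst hxj; rw [sym]; exact hno y (Ne.symm hxy) hy
        · by_cases hyj : y = j
          · subst hyj; exact hno x hxy hx
          · rw [happ] at hx hy
            simp [Ne.symm hxj] at hx
            simp [Ne.symm hyj] at hy
            exact ha2 x y hxy (by omega) (by omega)
    obtain ⟨k, hkj, hk1, hk0⟩ := hk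
    rw [happ] at hk1
    simp [Ne.symm hkj] at hk1
    have hak : 1 ≤ a k := by omega
    have hbk : b k = 0 := by
      by_contra h
      exact hb2 k j hkj (by omega) (by omega) hk0
    obtain ⟨p, hp⟩ := niso a had ha1 ha2 k hak
    obtain ⟨q, hq⟩ := niso b hbd hb1 hb2 j (by omega)
    have hjj := zs k p j j hp hk0 hk0
    have hkk := zs j q k k hq (sym k j ▸ hk0) (sym k j ▸ hk0)
    have hak2 : a k = 1 := by
      by_contra h; exact ha1 k (by omega) hkk
    have hbj : b j = 1 := by
      by_contra h; exact hb1 j (by omega) hjj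
    refine ⟨k, ?_, by omega, hak2, hbj, by omega, hk0⟩
    rintro rfl
    simp at hk1
    omega
  choose! κ hκi hκab hκa hκb hκj hκ0 using hbad
  have hsum : ∑ x, ((a x : ℤ) - b x) = 0 := by
    rw [Finset.sum_sub_distrib]
    have h1 := had; have h2 := hbd
    rw [Finsupp.degree_eq_sum] at h1 h2
    have h3 : (∑ x, (a x : ℤ)) = t := by exact_mod_cast h1
    have h4 : (∑ x, (b x : ℤ)) = t := by exact_mod_cast h2
    rw [h3, h4]; ring
  classical
  set J := Finset.univ.filter fun j => a j < b j with hJ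
  have hJm : ∀ j, j ∈ J ↔ a j < b j := by intro j; simp [hJ]
  have hinj : Set.InjOn κ J := by
    intro x hx y hy hxy
    have hx' := (hJm x).mp hx
    have hy' := (hJm y).mp hy
    by_contra hne
    obtain ⟨p, hp⟩ := niso a had ha1 ha2 (κ x) (by have := hκab x hx'; omega)
    have := zs (κ x) p x y hp (hκ0 x hx') (by rw [hxy]; exact hκ0 y hy')
    exact hb2 x y hne (by omega) (by omega) this
  have hiJ : i ∉ J := by rw [hJm]; omega
  have hiK : i ∉ J.image κ := by
    intro h
    obtain ⟨x, hx, hxi⟩ := Finset.mem_image.mp h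
    exact hκi x ((hJm x).mp hx) hxi
  have hdis : Disjoint J (J.image κ) := by
    rw [Finset.disjoint_left]
    intro y hy hy2
    obtain ⟨x, hx, hxi⟩ := Finset.mem_image.mp hy2
    have := hκab x ((hJm x).mp hx)
    have h3 := (hJm y).mp hy
    rw [hxi] at this; omega
  have s1 : ∑ x ∈ J, ((a x : ℤ) - b x) = - J.card := by
    rw [Finset.sum_congr rfl (g := fun _ => (-1 : ℤ))]
    · simp
    · intro x hx
      have hx' := (hJm x).mp hx
      rw [hκb x hx', hκj x hx']; simp
  have s2 : (J.card : ℤ) ≤ ∑ x ∈ J.image κ, ((a x : ℤ) - b x) := by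
    rw [Finset.sum_image hinj]
    rw [Finset.card_eq_sum_ones]
    push_cast
    refine Finset.sum_le_sum fun x hx => ?_
    have := hκab x ((hJm x).mp hx)
    omega
  have s3 : ∑ x ∈ insert i (J ∪ J.image κ), ((a x : ℤ) - b x) ≤ ∑ x, ((a x : ℤ) - b x) := by
    refine Finset.sum_le_sum_of_subset_of_nonneg (Finset.subset_univ _) fun x _ hx => ?_
    have : x ∉ J := fun h => hx (by simp [h])
    rw [hJm] at this
    omega
  rw [Finset.sum_insert (by simp only [Finset.mem_union, not_or]; exact ⟨hiJ, hiK⟩),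
    Finset.sum_union hdis] at s3
  omega

/-- coefficient pattern preserved by partial derivatives -/
def CoeffForm {n : ℕ} (G : Matrix (Fin n) (Fin n) ℝ) (K : ℝ) (b : Fin n →₀ ℕ) (d : ℕ)
    (f : MvPolynomial (Fin n) ℝ) : Prop :=
  ∀ m : Fin n →₀ ℕ, f.coeff m * ∏ k, ((m k).factorial : ℝ) =
    if m.degree = d then K * wt G (b + m) else 0

lemma fact_pos {n : ℕ} (m : Fin n →₀ ℕ) : (0 : ℝ) < ∏ k, ((m k).factorial : ℝ) :=
  Finset.prod_pos fun k _ => by exact_mod_cast Nat.factorial_pos _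

lemma CoeffForm.pderiv {n : ℕ} {G : Matrix (Fin n) (Fin n) ℝ} {K : ℝ} {b : Fin n →₀ ℕ} {d : ℕ}
    {f : MvPolynomial (Fin n) ℝ} (h : CoeffForm G K b (d + 1) f) (i : Fin n) :
    CoeffForm G K (b + Finsupp.single i 1) d (MvPolynomial.pderiv i f) := by
  intro m
  have h1 := h (m + Finsupp.single i 1)
  have h2 : ∏ k, (((m + Finsupp.single i 1 : Fin n →₀ ℕ) k).factorial : ℝ)
      = (m i + 1) * ∏ k, ((m k).factorial : ℝ) := by
    have : ∀ k, (((m + Finsupp.single i 1 : Fin n →₀ ℕ) k).factorial : ℝ)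
        = (if k = i then (m i + 1 : ℝ) else 1) * ((m k).factorial : ℝ) := by
      intro k
      by_cases hk : k = i
      · subst hk; simp [Nat.factorial_succ]
      · simp [hk, Finsupp.single_apply, Ne.symm hk]
    simp only [this, Finset.prod_mul_distrib]
    simp
  rw [h2, map_add, Finsupp.degree_single] at h1
  rw [MvPolynomial.coeff_pderiv, mul_assoc, h1]
  simp only [add_left_inj]
  rw [add_assoc b, add_comm m]

lemma lorentz_main {n : ℕ} (G : Matrix (Fin n) (Fin n) ℝ) (hG : G.IsHermitian)
    (hnn : ∀ i j, 0 ≤ G i j)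
    (c : Fin n → ℝ) (hc : ∀ x, c ⬝ᵥ x = 0 → x ⬝ᵥ G *ᵥ x ≤ 0) (K : ℝ) (hK : 0 < K) (d : ℕ) :
    ∀ (b : Fin n →₀ ℕ) (f : MvPolynomial (Fin n) ℝ), CoeffForm G K b (d + 2) f →
      IsLorentzian (d + 2) f := by
  have sym : ∀ a b, G a b = G b a := fun a b => by simpa using hG.apply b a
  have hom : ∀ (e : ℕ) (b : Fin n →₀ ℕ) (f : MvPolynomial (Fin n) ℝ), CoeffForm G K b e f →
      f.IsHomogeneous e := by
    intro e b f hf m hm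
    have := hf m
    by_contra hne
    rw [if_neg (by rwa [Finsupp.degree_eq_weight_one])] at this
    exact mul_ne_zero hm (fact_pos m).ne' this
  have nn : ∀ (e : ℕ) (b : Fin n →₀ ℕ) (f : MvPolynomial (Fin n) ℝ), CoeffForm G K b e f →
      ∀ m, 0 ≤ f.coeff m := by
    intro e b f hf m
    have := hf m
    refine nonneg_of_mul_nonneg_left ?_ (fact_pos m)
    rw [this]
    split_ifs
    · exact mul_nonneg hK.le (wt_nonneg G hnn _)
    · exact le_rfl
  induction d with
  | zero =>
    intro b f hf
    have hH : ∀ i j, polyHessian f i j =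
        K * wt G b * (∏ k, G i k ^ b k) * (∏ k, G j k ^ b k) * G i j := by
      intro i j
      have := (CoeffForm.pderiv (d := 0) (CoeffForm.pderiv (d := 1) hf j) i) 0
      simp at this
      unfold polyHessian
      rw [this, wt_add_single G sym, wt_add_single G sym]
      have e : ∏ k, G i k ^ (b + Finsupp.single j 1 : Fin n →₀ ℕ) k
          = (∏ k, G i k ^ b k) * G i j := by
        simp only [Finsupp.add_apply, pow_add, Finset.prod_mul_distrib]
        congr 1
        rw [Finset.prod_eq_single j]
        · simp
        · intro x _ hx; simp [Finsupp.single_apply, Ne.symm hx]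
        · simp
      rw [e]; ring
    set u : Fin n → ℝ := fun i => ∏ k, G i k ^ b k with hu
    have hherm : (polyHessian f).IsHermitian := by
      ext i j
      simp only [Matrix.conjTranspose_apply, star_trivial, hH]
      rw [sym j i]; ring
    refine ⟨hom _ b f hf, nn _ b f hf, fun i j => ?_, hherm, ?_⟩
    · rw [hH]
      have hu0 : ∀ i, 0 ≤ ∏ k, G i k ^ b k :=
        fun i => Finset.prod_nonneg fun k _ => pow_nonneg (hnn _ _) _
      have := wt_nonneg G hnn b
      have := hu0 i; have := hu0 j; have := hnn i j
      positivity
    · refine functional_afm _ hherm (fun i => c i * u i) fun x hx => ?_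
      have h1 := hc (fun i => u i * x i) (by
        rw [← hx]; simp only [dotProduct]
        exact Finset.sum_congr rfl fun i _ => by ring)
      have h2 : x ⬝ᵥ polyHessian f *ᵥ x = K * wt G b *
          ((fun i => u i * x i) ⬝ᵥ G *ᵥ (fun i => u i * x i)) := by
        simp only [dotProduct, Matrix.mulVec, Finset.mul_sum, hH]
        refine Finset.sum_congr rfl fun i _ => Finset.sum_congr rfl fun j _ => ?_
        simp only [hu]; ring
      rw [h2]
      exact mul_nonpos_of_nonneg_of_nonpos (mul_nonneg hK.le (wt_nonneg G hnn b)) h1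
  | succ d ih =>
    intro b f hf
    refine ⟨hom _ b f hf, nn _ b f hf, ?_, fun i => ih _ _ (CoeffForm.pderiv hf i)⟩
    have hsupp : ∀ m, m ∈ (f.support : Set (Fin n →₀ ℕ)) ↔
        (b + m ∈ {m : Fin n →₀ ℕ | m.degree = b.degree + (d + 1 + 2) ∧ wt G m ≠ 0}) := by
      intro m
      rw [Finset.mem_coe, MvPolynomial.mem_support_iff]
      have := hf m
      have h3 : f.coeff m ≠ 0 ↔ f.coeff m * ∏ k, ((m k).factorial : ℝ) ≠ 0 := by
        simp only [ne_eq, mul_eq_zero, (fact_pos m).ne', or_false]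
      rw [h3, this]
      simp only [Set.mem_ofPred_eq, map_add, add_right_inj]
      split_ifs with h
      · simp [h, hK.ne']
      · simp [h]
    intro x hx y hy i hi
    rw [hsupp] at hx hy
    obtain ⟨j, hj, hj2⟩ := mconvex_wt G sym (zero_struct G hG hnn c hc) _ (by omega) _ hx _ hy i
      (by simpa using hi)
    refine ⟨j, by simpa using hj, ?_⟩
    rw [hsupp]
    convert hj2 using 1
    ext k
    simp only [Finsupp.add_apply, Finsupp.tsub_apply, Finsupp.single_apply]
    split_ifs with h1 h2 h2
    · subst h1; omega
    · subst h1; omega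
    · omega
    · omega

/-- content of a colouring -/
noncomputable def content {n t : ℕ} (φ : Fin t → Fin n) : Fin n →₀ ℕ :=
  ∑ v, Finsupp.single (φ v) 1

lemma wt_content {n : ℕ} (G : Matrix (Fin n) (Fin n) ℝ) (sym : ∀ a b, G a b = G b a) (t : ℕ) :
    ∀ φ : Fin t → Fin n,
    (∏ u : Fin t, ∏ v : Fin t, if u < v then G (φ u) (φ v) else 1) = wt G (content φ) := by
  induction t with
  | zero => intro φ; simp [content, wt_zero]
  | succ t ih =>
    intro φ
    have hcont : content φ = content (fun v => φ (Fin.succ v)) + Finsupp.single (φ 0) 1 := by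
      simp only [content]
      rw [Fin.sum_univ_succ, add_comm]
    rw [hcont, wt_add_single G sym, ← ih]
    rw [Fin.prod_univ_succ]
    simp only [Fin.prod_univ_succ (n := t), Fin.succ_lt_succ_iff, lt_irrefl, if_false, one_mul,
      Fin.succ_pos, if_true, Fin.not_lt_zero]
    rw [mul_comm]
    congr 1
    have : ∀ k, G (φ 0) k ^ (content (fun v : Fin t => φ (Fin.succ v))) k
        = ∏ v : Fin t, G (φ 0) k ^ (Finsupp.single (φ (Fin.succ v)) 1 : Fin n →₀ ℕ) k := by
      intro k
      rw [Finset.prod_pow_eq_pow_sum, content, Finsupp.finset_sum_apply]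
    simp only [this]
    rw [Finset.prod_comm]
    refine Finset.prod_congr rfl fun v _ => ?_
    rw [Finset.prod_eq_single (φ (Fin.succ v))]
    · simp
    · intro x _ hx; simp [Finsupp.single_apply, Ne.symm hx]
    · simp

lemma edge_prod {n t : ℕ} (G : Matrix (Fin n) (Fin n) ℝ) (hG : G.IsHermitian)
    (φ : Fin t → Fin n) [inst : Fintype (completeGraph (Fin t)).edgeSet] :
    (∏ e ∈ (completeGraph (Fin t)).edgeFinset, edgeWeight G hG (e.map φ))
      = ∏ u : Fin t, ∏ v : Fin t, if u < v then G (φ u) (φ v) else 1 := by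
  have h := Finset.sum_sym2_filter_not_isDiag (M := Additive ℝ) (Finset.univ : Finset (Fin t))
    (fun e => Additive.ofMul (edgeWeight G hG (e.map φ)))
  have h' : ∏ e ∈ (Finset.univ : Finset (Fin t)).sym2 with ¬ e.IsDiag, edgeWeight G hG (e.map φ)
      = ∏ i ∈ (Finset.univ : Finset (Fin t)).offDiag with i.1 < i.2,
        edgeWeight G hG ((s(i.1, i.2) : Sym2 (Fin t)).map φ) := h
  have hE : (completeGraph (Fin t)).edgeFinset =
      (Finset.univ : Finset (Fin t)).sym2.filter (fun e => ¬ e.IsDiag) := by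
    ext e
    induction e with
    | _ a b => simp
  rw [hE, h', ← Finset.prod_product', Finset.univ_product_univ, ← Finset.prod_filter]
  refine Finset.prod_congr ?_ fun x _ => ?_
  · ext x
    simp only [Finset.mem_filter, Finset.mem_offDiag, Finset.mem_univ, true_and]
    exact ⟨fun h => h.2, fun h => ⟨h.ne, h⟩⟩
  · rfl

lemma prod_X_content {n t : ℕ} (φ : Fin t → Fin n) :
    (∏ v, MvPolynomial.X (φ v) : MvPolynomial (Fin n) ℝ) = MvPolynomial.monomial (content φ) 1 := by
  rw [content, MvPolynomial.monomial_sum_one]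
  rfl

lemma chrom_form {n t : ℕ} (G : Matrix (Fin n) (Fin n) ℝ) (hG : G.IsHermitian) :
    CoeffForm G (t.factorial : ℝ) 0 t (chromPoly (completeGraph (Fin t)) G hG) := by
  classical
  have sym : ∀ a b, G a b = G b a := fun a b => by simpa using hG.apply b a
  intro m
  have h1 : (chromPoly (completeGraph (Fin t)) G hG).coeff m =
      wt G m * ((∑ i, MvPolynomial.X i : MvPolynomial (Fin n) ℝ) ^ t).coeff m := by
    rw [Fintype.sum_pow, chromPoly, MvPolynomial.coeff_sum, MvPolynomial.coeff_sum, Finset.mul_sum]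
    refine Finset.sum_congr (by ext; simp) fun φ _ => ?_
    rw [edge_prod, wt_content G sym, prod_X_content, MvPolynomial.coeff_C_mul,
      MvPolynomial.coeff_monomial]
    split_ifs with h
    · rw [h]
    · simp
  rw [h1, MvPolynomial.coeff_sum_X_pow_of_fintype]
  have hd : m.sum (fun _ k => k) = m.degree := by
    rw [Finsupp.degree_eq_sum, Finsupp.sum_fintype]; simp
  rw [hd, zero_add]
  split_ifs with h
  · have h2 : (∏ k, (m k).factorial) * m.multinomial = t.factorial := by
      rw [← h, ← hd]
      have h3 := Nat.multinomial_spec m.support m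
      rw [Finsupp.multinomial_eq, Finsupp.sum, ← h3]
      congr 1
      symm
      refine Finset.prod_subset (Finset.subset_univ _) fun x _ hx => ?_
      rw [Finsupp.notMem_support_iff.mp hx]; rfl
    rw [← h2]; push_cast; ring
  · simp


end Helpers

/-- For an antiferromagnetic weighted graph `G` on `[n]` and `t ≥ 2`,
the `G`-chromatic function `h_{K_t}(x; G)` is Lorentzian. -/
theorem stmt3 {n t : ℕ} (ht : 2 ≤ t)
    (G : Matrix (Fin n) (Fin n) ℝ) (hG : G.IsHermitian)
    (hnn : ∀ i j, 0 ≤ G i j)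
    (hafm : {i | 0 < hG.eigenvalues i}.Subsingleton) :
    IsLorentzian t (chromPoly (completeGraph (Fin t)) G hG) := by
  obtain ⟨c, hc⟩ := afm_functional G hG hafm
  obtain ⟨d, rfl⟩ := Nat.exists_eq_add_of_le' ht
  exact lorentz_main G hG hnn c hc _ (by exact_mod_cast Nat.factorial_pos (d + 2)) d 0 _
    (chrom_form G hG)
end

section
/- Let G be an unweighted graph, possibly with loops, in which every vertex is incident to at least one edge (a loop counts as an edge). Then the following are equivalent: (1) G is antiferromagnetic, i.e. its {0,1} adjacency matrix has at most one positive eigenvalue counting multiplicities; (2) the quadratic form Q_G(x) = ½ xᵀ A_G x is a Lorentzian polynomial; (3) the support of Q_G is M-convex; (4) V(G) splits into disjoint sets V_1 and V_2 such that V_1 induces a loopless complete multipartite graph and V_2 consists of looped vertices each adjacent to every vertex of G (equivalently, G is a blow-up of K_q or of K_q^∘ for some q). -/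
/-- The quadratic form `Q_G(x) = ½ xᵀ A x` of a graph with adjacency matrix `A`,
as a multivariate polynomial. -/
noncomputable def qform {n : ℕ} (A : Matrix (Fin n) (Fin n) ℝ) : MvPolynomial (Fin n) ℝ :=
  MvPolynomial.C (1 / 2 : ℝ) *
    ∑ i : Fin n, ∑ j : Fin n, MvPolynomial.C (A i j) * (MvPolynomial.X i * MvPolynomial.X j)


open Matrix in
lemma bil_sum {n : ℕ} (A : Matrix (Fin n) (Fin n) ℝ) (x y : Fin n → ℝ) :
    x ⬝ᵥ (A *ᵥ y) = ∑ i, ∑ j, A i j * (x i * y j) := by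
  simp only [dotProduct, mulVec, Finset.mul_sum]
  refine Finset.sum_congr rfl fun i _ => Finset.sum_congr rfl fun j _ => by ring

lemma bil_add_left {n : ℕ} (A : Matrix (Fin n) (Fin n) ℝ) (hA : A.IsHermitian) (x y : Fin n → ℝ) :
    x ⬝ᵥ (A.mulVec y) = y ⬝ᵥ (A.mulVec x) := by
  rw [Matrix.dotProduct_mulVec, dotProduct_comm, ← Matrix.mulVec_transpose]
  congr 2

lemma spec_bil {n : ℕ} (A : Matrix (Fin n) (Fin n) ℝ) (hA : A.IsHermitian) :
    ∃ U : Matrix (Fin n) (Fin n) ℝ, ∀ x, x ⬝ᵥ (A.mulVec x) =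
      ∑ i, hA.eigenvalues i * (U.mulVec x i) ^ 2 := by
  refine ⟨(star (hA.eigenvectorUnitary : Matrix (Fin n) (Fin n) ℝ)), fun x => ?_⟩
  conv_lhs => rw [hA.spectral_theorem, Unitary.conjStarAlgAut_apply]
  rw [← Matrix.mulVec_mulVec, ← Matrix.mulVec_mulVec, Matrix.dotProduct_mulVec,
    ← Matrix.mulVec_transpose]
  simp only [dotProduct, Matrix.mulVec_diagonal, Matrix.star_eq_conjTranspose, 
    Matrix.conjTranspose_eq_transpose_of_trivial]
  refine Finset.sum_congr rfl fun i _ => ?_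
  simp
  ring

lemma quad_comb {n : ℕ} (A : Matrix (Fin n) (Fin n) ℝ) (hA : A.IsHermitian)
    (x y : Fin n → ℝ) (a b : ℝ) : (a • x + b • y) ⬝ᵥ (A.mulVec (a • x + b • y)) =
      a ^ 2 * (x ⬝ᵥ (A.mulVec x)) + b ^ 2 * (y ⬝ᵥ (A.mulVec y))
        + 2 * a * b * (x ⬝ᵥ (A.mulVec y)) := by
  simp only [Matrix.mulVec_add, Matrix.mulVec_smul, add_dotProduct, dotProduct_add,
    smul_dotProduct, dotProduct_smul, smul_eq_mul]
  rw [bil_add_left A hA y x]; ring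

lemma eig_one {n : ℕ} (A : Matrix (Fin n) (Fin n) ℝ) (hA : A.IsHermitian)
    (hs : {i | 0 < hA.eigenvalues i}.Subsingleton) (x y : Fin n → ℝ)
    (hx : 0 < x ⬝ᵥ (A.mulVec x)) (hy : 0 < y ⬝ᵥ (A.mulVec y)) (hxy : x ⬝ᵥ (A.mulVec y) = 0) :
    False := by
  obtain ⟨U, hU⟩ := spec_bil A hA
  have key : ∀ z : Fin n → ℝ, (∀ i, 0 < hA.eigenvalues i → U.mulVec z i = 0) →
      z ⬝ᵥ (A.mulVec z) ≤ 0 := by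
    intro z hz
    rw [hU]
    refine Finset.sum_nonpos fun i _ => ?_
    by_cases h : 0 < hA.eigenvalues i
    · simp [hz i h]
    · exact mul_nonpos_of_nonpos_of_nonneg (not_lt.mp h) (sq_nonneg _)
  by_cases he : ∃ i, 0 < hA.eigenvalues i
  · obtain ⟨i, hi⟩ := he
    have h1 : ∀ z : Fin n → ℝ, U.mulVec z i = 0 → z ⬝ᵥ (A.mulVec z) ≤ 0 := by
      intro z hz
      refine key z fun j hj => ?_
      have : j = i := hs hj hi
      rw [this, hz]
    have h2 := h1 ((U.mulVec y i) • x + (-(U.mulVec x i)) • y) (by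
      simp [Matrix.mulVec_add, Matrix.mulVec_smul, Matrix.mulVec_neg]; ring)
    rw [quad_comb A hA, hxy] at h2
    have hx0 : U.mulVec x i ≠ 0 := fun h => absurd (h1 x h) (not_le.mpr hx)
    have : 0 < (U.mulVec x i)^2 := by positivity
    nlinarith [mul_pos this hy, mul_nonneg (sq_nonneg (U.mulVec y i)) hx.le]
  · push Not at he
    exact absurd (key x fun i hi => absurd hi (not_lt.mpr (he i))) (not_le.mpr hx)

lemma eig_two {n : ℕ} (A : Matrix (Fin n) (Fin n) ℝ) (hA : A.IsHermitian)
    (h : ∀ x : Fin n → ℝ, ∑ i, x i = 0 → x ⬝ᵥ (A.mulVec x) ≤ 0) :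
    {i | 0 < hA.eigenvalues i}.Subsingleton := by
  intro i hi j hj
  by_contra hij
  simp only [Set.mem_setOf_eq] at hi hj
  have ho : ∀ a b, (hA.eigenvectorBasis a : Fin n → ℝ) ⬝ᵥ
      (A.mulVec (hA.eigenvectorBasis b : Fin n → ℝ)) = if a = b then hA.eigenvalues b else 0 := by
    intro a b
    rw [hA.mulVec_eigenvectorBasis, dotProduct_smul]
    have := hA.eigenvectorBasis.inner_eq_ite b a
    simp only [EuclideanSpace.inner_eq_star_dotProduct] at this
    simp only [star_trivial] at this
    rw [this]
    by_cases hab : a = b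
    · simp [hab]
    · simp [hab, Ne.symm hab]
  set u : Fin n → ℝ := (hA.eigenvectorBasis i : Fin n → ℝ)
  set v : Fin n → ℝ := (hA.eigenvectorBasis j : Fin n → ℝ)
  have huu : u ⬝ᵥ (A.mulVec u) = hA.eigenvalues i := by simpa using ho i i
  have hvv : v ⬝ᵥ (A.mulVec v) = hA.eigenvalues j := by simpa using ho j j
  have huv : u ⬝ᵥ (A.mulVec v) = 0 := by simpa [hij] using ho i j
  have hu0 : ∑ k, u k ≠ 0 := fun h0 => by
    have := h u h0
    linarith
  have h2 := h ((∑ k, v k) • u + (-(∑ k, u k)) • v) (by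
    simp [Finset.sum_add_distrib, ← Finset.mul_sum]; ring)
  rw [quad_comb A hA, huu, hvv, huv] at h2
  have : 0 < (∑ k, u k)^2 := by positivity
  nlinarith [mul_pos this hj, mul_nonneg (sq_nonneg (∑ k, v k)) hi.le]

lemma one_to_P {n : ℕ} (A : Matrix (Fin n) (Fin n) ℝ) (hA : A.IsHermitian)
    (h01 : ∀ i j, A i j = 0 ∨ A i j = 1)
    (hdeg : ∀ i, ∃ j, A i j = 1)
    (hs : {i | 0 < hA.eigenvalues i}.Subsingleton) :
    ∀ v p q, A p q = 1 → A v p = 1 ∨ A v q = 1 := by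
  intro v p q hpq
  by_contra hcon
  push Not at hcon
  have hvp : A v p = 0 := (h01 v p).resolve_right hcon.1
  have hvq : A v q = 0 := (h01 v q).resolve_right hcon.2
  have hsym : ∀ i j, A i j = A j i := fun i j => by
    have := hA.apply i j
    simpa using this.symm
  obtain ⟨z, hz⟩ := hdeg v
  have h0 : ∀ i j, 0 ≤ A i j := fun i j => by rcases h01 i j with h | h <;> simp [h]
  have h1 : ∀ i j, A i j ≤ 1 := fun i j => by rcases h01 i j with h | h <;> simp [h]
  have hee : ∀ i j, (Pi.single i (1:ℝ) : Fin n → ℝ) ⬝ᵥ (A.mulVec (Pi.single j 1)) = A i j := by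
    intro i j; simp
  set x : Fin n → ℝ := Pi.single p 1 + Pi.single q 1 with hx
  set d := 2 + A p p + A q q with hd
  have hdpos : 2 ≤ d := by linarith [h0 p p, h0 q q]
  set s := A p z + A q z with hsd
  have hxx : x ⬝ᵥ (A.mulVec x) = d := by
    simp only [hx, Matrix.mulVec_add, add_dotProduct, dotProduct_add, hee, hsym q p, hpq, hd]
    ring
  set w : Fin n → ℝ := Pi.single z 1 + (2:ℝ) • Pi.single v 1 with hw
  have hxw : x ⬝ᵥ (A.mulVec w) = s := by
    simp only [hx, hw, Matrix.mulVec_add, Matrix.mulVec_smul, add_dotProduct, dotProduct_add,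
      dotProduct_smul, hee, hsym q v, hsym p v, hvp, hvq, hsd]
    simp
  have hww : w ⬝ᵥ (A.mulVec w) = A z z + 4 + 4 * A v v := by
    simp only [hw, Matrix.mulVec_add, Matrix.mulVec_smul, add_dotProduct, dotProduct_add,
      dotProduct_smul, smul_dotProduct, hee, hsym z v, hz, smul_eq_mul]
    ring
  have hs2 : s ^ 2 / d ≤ 2 := by
    rw [div_le_iff₀ (by linarith)]
    nlinarith [h0 p z, h0 q z, h1 p z, h1 q z]
  refine eig_one A hA hs x ((1:ℝ) • w + (-(s/d)) • x) (by rw [hxx]; linarith) ?_ ?_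
  · rw [quad_comb A hA, hww, bil_add_left A hA w x, hxw, hxx]
    have : (-(s/d))^2 * d = s^2/d := by field_simp
    have h3 : 2 * 1 * (-(s/d)) * s = - 2 * (s^2/d) := by ring
    rw [this, h3]
    linarith [h0 z z, h0 v v]
  · simp only [Matrix.mulVec_add, Matrix.mulVec_smul, dotProduct_add, dotProduct_smul, hxw, hxx,
      smul_eq_mul]
    field_simp
    ring

lemma P_to_four {n : ℕ} (A : Matrix (Fin n) (Fin n) ℝ) (hA : A.IsHermitian)
    (h01 : ∀ i j, A i j = 0 ∨ A i j = 1)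
    (hdeg : ∀ i, ∃ j, A i j = 1)
    (hP : ∀ v p q, A p q = 1 → A v p = 1 ∨ A v q = 1) :
    ∃ c : Fin n → ℕ,
        (∀ v, A v v = 1 → ∀ w, A v w = 1) ∧
        (∀ v w, v ≠ w → A v v = 0 → A w w = 0 → (A v w = 1 ↔ c v ≠ c w)) := by
  have hsym : ∀ i j, A i j = A j i := fun i j => by
    have := hA.apply i j
    simpa using this.symm
  have htr : ∀ a b c, A a b = 0 → A b c = 0 → A a c = 0 := by
    intro a b c hab hbc
    rcases h01 a c with h | h
    · exact h
    · rcases hP b a c h with h' | h'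
      · rw [hsym, hab] at h'; exact absurd h' (by norm_num)
      · rw [hbc] at h'; exact absurd h' (by norm_num)
  refine ⟨fun v => sInf {k : ℕ | ∃ w : Fin n, w.val = k ∧ A v w = 0}, ?_, ?_⟩
  · intro v hv w
    rw [hsym]
    rcases hP w v v hv with h | h <;> exact h
  · intro v w _ hv hw
    constructor
    · intro h hc
      have hc' : sInf {k : ℕ | ∃ u : Fin n, u.val = k ∧ A v u = 0} =
        sInf {k : ℕ | ∃ u : Fin n, u.val = k ∧ A w u = 0} := hc
      obtain ⟨u, hu, hvu⟩ := Nat.sInf_mem (s := {k : ℕ | ∃ u : Fin n, u.val = k ∧ A v u = 0})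
        ⟨v.val, v, rfl, hv⟩
      obtain ⟨u', hu', hwu⟩ := Nat.sInf_mem (s := {k : ℕ | ∃ u : Fin n, u.val = k ∧ A w u = 0})
        ⟨w.val, w, rfl, hw⟩
      have : u = u' := Fin.ext (by rw [hu, hu', hc'])
      subst this
      rw [htr v u w hvu (by rw [hsym, hwu])] at h
      exact absurd h (by norm_num)
    · intro h
      rcases h01 v w with h0 | h0
      · exfalso
        apply h
        have : {k : ℕ | ∃ u : Fin n, u.val = k ∧ A v u = 0} =
          {k : ℕ | ∃ u : Fin n, u.val = k ∧ A w u = 0} := by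
          ext k
          constructor
          · rintro ⟨u, hu, h⟩
            exact ⟨u, hu, htr w v u (by rw [hsym, h0]) h⟩
          · rintro ⟨u, hu, h⟩
            exact ⟨u, hu, htr v w u h0 h⟩
        simp only [this]
      · exact h0

lemma four_to_P {n : ℕ} (A : Matrix (Fin n) (Fin n) ℝ) (hA : A.IsHermitian)
    (h01 : ∀ i j, A i j = 0 ∨ A i j = 1) (c : Fin n → ℕ)
    (hl : ∀ v, A v v = 1 → ∀ w, A v w = 1)
    (hc : ∀ v w, v ≠ w → A v v = 0 → A w w = 0 → (A v w = 1 ↔ c v ≠ c w)) :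
    ∀ v p q, A p q = 1 → A v p = 1 ∨ A v q = 1 := by
  have hsym : ∀ i j, A i j = A j i := fun i j => by
    have := hA.apply i j
    simpa using this.symm
  intro v p q hpq
  rcases h01 v v with hv | hv
  swap
  · exact Or.inl (hl v hv p)
  rcases h01 p p with hp | hp
  swap
  · exact Or.inl (by rw [hsym]; exact hl p hp v)
  rcases h01 q q with hq | hq
  swap
  · exact Or.inr (by rw [hsym]; exact hl q hq v)
  have hne : p ≠ q := by rintro rfl; rw [hp] at hpq; exact absurd hpq (by norm_num)
  by_cases h1 : v = p
  · subst h1; exact Or.inr hpq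
  by_cases h2 : v = q
  · subst h2; exact Or.inl (by rw [hsym]; exact hpq)
  rw [hc v p h1 hv hp, hc v q h2 hv hq]
  have := (hc p q hne hp hq).1 hpq
  by_contra hcon
  push Not at hcon
  exact this (hcon.1.symm.trans hcon.2)

lemma four_to_one {n : ℕ} (A : Matrix (Fin n) (Fin n) ℝ) (hA : A.IsHermitian)
    (h01 : ∀ i j, A i j = 0 ∨ A i j = 1) (c : Fin n → ℕ)
    (hl : ∀ v, A v v = 1 → ∀ w, A v w = 1)
    (hc : ∀ v w, v ≠ w → A v v = 0 → A w w = 0 → (A v w = 1 ↔ c v ≠ c w)) :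
    {i | 0 < hA.eigenvalues i}.Subsingleton := by
  have hsym : ∀ i j, A i j = A j i := fun i j => by
    have := hA.apply i j
    simpa using this.symm
  apply eig_two
  intro x hx
  let K := Finset.univ.image c
  let f : ℕ → Fin n → ℝ := fun k v => if A v v = 0 ∧ c v = k then 1 else 0
  have hAe : ∀ i j, A i j = 1 - ∑ k ∈ K, f k i * f k j := by
    intro i j
    have : ∑ k ∈ K, f k i * f k j = if A i i = 0 ∧ A j j = 0 ∧ c i = c j then 1 else 0 := by
      rw [Finset.sum_eq_single (c i)]
      · simp only [f, mul_ite, mul_one, mul_zero]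
        by_cases h1 : A i i = 0 <;> by_cases h2 : A j j = 0 <;> simp [h1, h2, eq_comm]
      · intro b _ hb
        simp [f, Ne.symm hb]
      · intro h
        exact absurd (Finset.mem_image_of_mem c (Finset.mem_univ i)) h
    rw [this]
    rcases h01 i i with hi | hi
    swap
    · simp [hi, hl i hi j]
    rcases h01 j j with hj | hj
    swap
    · simp [hj, hsym i j, hl j hj i]
    by_cases hij : i = j
    · subst hij; simp [hi]
    have := hc i j hij hi hj
    by_cases hcc : c i = c j
    · simp only [hi, hj, hcc, true_and, if_true, sub_self]
      exact (h01 i j).resolve_right fun h => (this.1 h) hcc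
    · simp only [hi, hj, hcc, true_and, if_false, sub_zero]
      exact this.2 hcc
  rw [bil_sum]
  have : ∑ i, ∑ j, A i j * (x i * x j) = (∑ i, x i) ^ 2 - ∑ k ∈ K, (∑ i, f k i * x i) ^ 2 := by
    simp only [pow_two, Finset.sum_mul_sum]
    rw [Finset.sum_comm (s := K), ← Finset.sum_sub_distrib]
    refine Finset.sum_congr rfl fun i _ => ?_
    rw [Finset.sum_comm (s := K), ← Finset.sum_sub_distrib]
    refine Finset.sum_congr rfl fun j _ => ?_
    rw [hAe i j, sub_mul, one_mul, Finset.sum_mul]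
    congr 1
    refine Finset.sum_congr rfl fun k _ => by ring
  rw [this, hx]
  have : 0 ≤ ∑ k ∈ K, (∑ i, f k i * x i) ^ 2 := Finset.sum_nonneg fun k _ => sq_nonneg _
  linarith

lemma qform_coeff {n : ℕ} (A : Matrix (Fin n) (Fin n) ℝ) (a : Fin n →₀ ℕ) :
    (qform A).coeff a = (1/2) * ∑ i, ∑ j,
      if Finsupp.single i 1 + Finsupp.single j 1 = a then A i j else 0 := by
  simp only [qform, MvPolynomial.coeff_C_mul, MvPolynomial.coeff_sum, MvPolynomial.X,
    MvPolynomial.monomial_mul, MvPolynomial.coeff_monomial]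
  simp

lemma qform_supp {n : ℕ} (A : Matrix (Fin n) (Fin n) ℝ)
    (h01 : ∀ i j, A i j = 0 ∨ A i j = 1) (a : Fin n →₀ ℕ) :
    a ∈ ((qform A).support : Set (Fin n →₀ ℕ)) ↔
      ∃ i j, A i j = 1 ∧ Finsupp.single i 1 + Finsupp.single j 1 = a := by
  have h0 : ∀ i j, 0 ≤ A i j := fun i j => by rcases h01 i j with h | h <;> simp [h]
  have hn : ∀ i j, 0 ≤ if Finsupp.single i 1 + Finsupp.single j 1 = a then A i j else 0 := by
    intro i j; split_ifs <;> simp [h0]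
  rw [Finset.mem_coe, MvPolynomial.mem_support_iff, qform_coeff]
  rw [Ne, mul_eq_zero, Finset.sum_eq_zero_iff_of_nonneg
    (fun i _ => Finset.sum_nonneg fun j _ => hn i j)]
  constructor
  · intro h
    by_contra hcon
    push Not at hcon
    apply h
    right
    intro i _
    refine Finset.sum_eq_zero fun j _ => ?_
    split_ifs with hh
    · exact (h01 i j).resolve_right fun h => hcon i j h hh
    · rfl
  · rintro ⟨i, j, hij, ha⟩ h
    rcases h with h | h
    · norm_num at h
    · have := (Finset.sum_eq_zero_iff_of_nonneg (fun j _ => hn i j)).1 (h i (Finset.mem_univ _)) j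
        (Finset.mem_univ _)
      rw [if_pos ha, hij] at this
      norm_num at this

lemma three_to_P {n : ℕ} (A : Matrix (Fin n) (Fin n) ℝ) (hA : A.IsHermitian)
    (h01 : ∀ i j, A i j = 0 ∨ A i j = 1)
    (hdeg : ∀ i, ∃ j, A i j = 1)
    (hM : MConvex ((qform A).support : Set (Fin n →₀ ℕ))) :
    ∀ v p q, A p q = 1 → A v p = 1 ∨ A v q = 1 := by
  have hsym : ∀ i j, A i j = A j i := fun i j => by
    have := hA.apply i j
    simpa using this.symm
  intro v p q hpq
  by_contra hcon
  push Not at hcon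
  obtain ⟨z, hz⟩ := hdeg v
  have hzp : z ≠ p := by rintro rfl; exact hcon.1 hz
  have hzq : z ≠ q := by rintro rfl; exact hcon.2 hz
  obtain ⟨j, hj, hS⟩ := hM _ ((qform_supp A h01 _).2 ⟨v, z, hz, rfl⟩) _
    ((qform_supp A h01 _).2 ⟨p, q, hpq, rfl⟩) z (by
      simp [Finsupp.single_apply, hzp.symm, hzq.symm])
  have hj' : j = p ∨ j = q := by
    by_contra hh
    push Not at hh
    simp [Finsupp.single_apply, hh.1.symm, hh.2.symm] at hj
  rw [add_tsub_cancel_right, qform_supp A h01] at hS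
  obtain ⟨a, b, hab, he⟩ := hS
  have hvj : A v j = 1 := by
    rcases (Finsupp.single_add_single_eq_single_add_single (one_ne_zero) one_ne_zero).1 he with
      ⟨rfl, rfl⟩ | ⟨_, rfl, rfl⟩ | ⟨h, _⟩
    · exact hab
    · rw [hsym, hab]
    · norm_num at h
  rcases hj' with rfl | rfl
  · exact hcon.1 hvj
  · exact hcon.2 hvj

lemma P_to_three {n : ℕ} (A : Matrix (Fin n) (Fin n) ℝ) (hA : A.IsHermitian)
    (h01 : ∀ i j, A i j = 0 ∨ A i j = 1)
    (hP : ∀ v p q, A p q = 1 → A v p = 1 ∨ A v q = 1) :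
    MConvex ((qform A).support : Set (Fin n →₀ ℕ)) := by
  have hsym : ∀ i j, A i j = A j i := fun i j => by
    have := hA.apply i j
    simpa using this.symm
  have main : ∀ i k p q, A i k = 1 → A p q = 1 →
      (Finsupp.single p 1 + Finsupp.single q 1 : Fin n →₀ ℕ) i <
        (Finsupp.single k 1 + Finsupp.single i 1 : Fin n →₀ ℕ) i →
      ∃ j, (Finsupp.single k 1 + Finsupp.single i 1 : Fin n →₀ ℕ) j <
        (Finsupp.single p 1 + Finsupp.single q 1 : Fin n →₀ ℕ) j ∧ A k j = 1 := by
    intro i k p q hik hpq hlt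
    have hloop : ∀ v w, A v v = 1 → A v w = 1 := by
      intro v w hv
      rw [hsym]
      rcases hP w v v hv with h | h <;> exact h
    have hqp : A q p = 1 := by rw [hsym, hpq]
    simp only [Finsupp.add_apply, Finsupp.single_apply] at hlt ⊢
    by_cases hki : k = i
    · subst hki
      by_cases hpk : p = k
      · have hqk : q ≠ k := by rintro rfl; simp [hpk] at hlt
        exact ⟨q, by simp [hqk.symm], hloop _ _ hik⟩
      · exact ⟨p, by simp [Ne.symm hpk], hloop _ _ hik⟩
    · have hpi : p ≠ i := by rintro rfl; simp [hki] at hlt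
      have hqi : q ≠ i := by rintro rfl; simp [hki] at hlt
      by_cases hpk : p = k
      · subst hpk
        refine ⟨q, ?_, hpq⟩
        by_cases hqk : q = p
        · subst hqk; simp [Ne.symm hqi]
        · simp [Ne.symm hqk, Ne.symm hqi]
      · by_cases hqk : q = k
        · subst hqk
          exact ⟨p, by simp [Ne.symm hpk, Ne.symm hpi], hqp⟩
        · rcases hP k p q hpq with h | h
          · exact ⟨p, by simp [Ne.symm hpk, Ne.symm hpi], h⟩
          · exact ⟨q, by simp [Ne.symm hqk, Ne.symm hqi], h⟩
  intro a ha b hb i hi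
  rw [qform_supp A h01] at ha hb
  obtain ⟨p, q, hpq, rfl⟩ := hb
  obtain ⟨k, l, hkl, rfl⟩ := ha
  have hil : i = l ∨ i = k := by
    by_contra hh
    push Not at hh
    simp [Finsupp.single_apply, Ne.symm hh.1, Ne.symm hh.2] at hi
  rcases hil with rfl | rfl
  · obtain ⟨j, hj, hkj⟩ := main i k p q (by rw [hsym, hkl]) hpq hi
    refine ⟨j, hj, ?_⟩
    rw [add_tsub_cancel_right, qform_supp A h01]
    exact ⟨k, j, hkj, rfl⟩
  · rw [add_comm (Finsupp.single i 1)] at hi ⊢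
    obtain ⟨j, hj, hkj⟩ := main i l p q hkl hpq hi
    refine ⟨j, hj, ?_⟩
    rw [add_tsub_cancel_right, qform_supp A h01]
    exact ⟨l, j, hkj, rfl⟩

lemma hess_eq {n : ℕ} (A : Matrix (Fin n) (Fin n) ℝ) (hA : A.IsHermitian) :
    polyHessian (qform A) = A := by
  have hsym : ∀ i j, A i j = A j i := fun i j => by
    have := hA.apply i j
    simpa using this.symm
  ext a b
  have : MvPolynomial.pderiv a (MvPolynomial.pderiv b (qform A)) = MvPolynomial.C (A a b) := by
    have h1 : MvPolynomial.pderiv b (qform A) =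
        ∑ i, MvPolynomial.C (A b i) * MvPolynomial.X i := by
      have h2 : ∀ i j, MvPolynomial.pderiv b (MvPolynomial.C (A i j) *
          (MvPolynomial.X i * MvPolynomial.X j)) =
          (if i = b then MvPolynomial.C (A b j) * MvPolynomial.X j else 0) +
          (if j = b then MvPolynomial.C (A b i) * MvPolynomial.X i else 0) := by
        intro i j
        rw [MvPolynomial.pderiv_C_mul, MvPolynomial.pderiv_mul, MvPolynomial.pderiv_X,
          MvPolynomial.pderiv_X]
        by_cases hi : i = b <;> by_cases hj : j = b <;>
          simp [hi, hj, hsym i b, Pi.single_apply, mul_add]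
      have h3 : MvPolynomial.C (1 / 2 : ℝ) * (2 : MvPolynomial (Fin n) ℝ) = 1 := by
        rw [show (2 : MvPolynomial (Fin n) ℝ) = MvPolynomial.C (2 : ℝ) from
            (map_ofNat MvPolynomial.C 2).symm,
          ← MvPolynomial.C_mul]
        norm_num
      rw [qform, MvPolynomial.pderiv_C_mul]
      simp only [map_sum, h2, Finset.sum_add_distrib, Finset.sum_ite_eq', Finset.mem_univ, if_true]
      rw [Finset.sum_comm]
      simp only [Finset.sum_ite_eq', Finset.mem_univ, if_true]
      rw [← two_mul, ← mul_assoc, h3, one_mul]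
    rw [h1]
    simp [MvPolynomial.pderiv_C_mul, map_sum, MvPolynomial.pderiv_X, Pi.single_apply, hsym a b,
      MvPolynomial.smul_eq_C_mul]
  simp [polyHessian, this]

lemma lor_iff {n : ℕ} (A : Matrix (Fin n) (Fin n) ℝ) (hA : A.IsHermitian)
    (h01 : ∀ i j, A i j = 0 ∨ A i j = 1) :
    {i | 0 < hA.eigenvalues i}.Subsingleton ↔ IsLorentzian 2 (qform A) := by
  have h0 : ∀ i j, 0 ≤ A i j := fun i j => by rcases h01 i j with h | h <;> simp [h]
  have hgen : ∀ B : Matrix (Fin n) (Fin n) ℝ, B = A → (({i | 0 < hA.eigenvalues i}.Subsingleton ↔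
      ∃ h : B.IsHermitian, {i | 0 < h.eigenvalues i}.Subsingleton)) := by
    rintro B rfl
    exact ⟨fun h => ⟨hA, h⟩, fun ⟨_, h⟩ => h⟩
  rw [hgen _ (hess_eq A hA)]
  unfold IsLorentzian
  constructor
  · intro h
    refine ⟨?_, ?_, ?_, h⟩
    · rw [qform]
      have : (2:ℕ) = 0 + 2 := rfl
      rw [this]
      refine (MvPolynomial.isHomogeneous_C _ _).mul ?_
      refine MvPolynomial.IsHomogeneous.sum _ _ _ fun i _ =>
        MvPolynomial.IsHomogeneous.sum _ _ _ fun j _ => ?_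
      rw [this]
      exact (MvPolynomial.isHomogeneous_C _ _).mul
        ((MvPolynomial.isHomogeneous_X _ _).mul (MvPolynomial.isHomogeneous_X _ _))
    · intro m
      rw [qform_coeff]
      refine mul_nonneg (by norm_num) (Finset.sum_nonneg fun i _ => Finset.sum_nonneg fun j _ => ?_)
      split_ifs <;> simp [h0]
    · rw [hess_eq A hA]; exact h0
  · exact fun h => h.2.2.2

/-- For an unweighted graph possibly with loops (a symmetric `{0,1}` matrix
`A`) without isolated vertices, the following are equivalent: (1) `A` has at most one positive
eigenvalue; (2) `Q_G` is Lorentzian; (3) the support of `Q_G` is M-convex; (4) the looped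
vertices are adjacent to every vertex, and the non-looped vertices induce a complete
multipartite graph (witnessed by a colouring `c`). -/
theorem stmt4 {n : ℕ} (A : Matrix (Fin n) (Fin n) ℝ) (hA : A.IsHermitian)
    (h01 : ∀ i j, A i j = 0 ∨ A i j = 1)
    (hdeg : ∀ i, ∃ j, A i j = 1) :
    ({i | 0 < hA.eigenvalues i}.Subsingleton ↔ IsLorentzian 2 (qform A)) ∧
    ({i | 0 < hA.eigenvalues i}.Subsingleton ↔
      MConvex ((qform A).support : Set (Fin n →₀ ℕ))) ∧
    ({i | 0 < hA.eigenvalues i}.Subsingleton ↔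
      ∃ c : Fin n → ℕ,
        (∀ v, A v v = 1 → ∀ w, A v w = 1) ∧
        (∀ v w, v ≠ w → A v v = 0 → A w w = 0 → (A v w = 1 ↔ c v ≠ c w))) := by
  have h4 : {i | 0 < hA.eigenvalues i}.Subsingleton ↔
      ∃ c : Fin n → ℕ,
        (∀ v, A v v = 1 → ∀ w, A v w = 1) ∧
        (∀ v w, v ≠ w → A v v = 0 → A w w = 0 → (A v w = 1 ↔ c v ≠ c w)) :=
    ⟨fun h => P_to_four A hA h01 hdeg (one_to_P A hA h01 hdeg h),
      fun ⟨c, hl, hc⟩ => four_to_one A hA h01 c hl hc⟩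
  exact ⟨lor_iff A hA h01,
    ⟨fun h => P_to_three A hA h01 (one_to_P A hA h01 hdeg h),
      fun h => h4.2 (P_to_four A hA h01 hdeg (three_to_P A hA h01 hdeg h))⟩, h4⟩
end

section
/- Let a ≤ b be positive integers, let k ≥ 2, and let r_1,…,r_k be positive integers. Fix subsets A ⊆ B ⊆ [b] with |A| = a and |B| = b. Then N_k(r_1,…,r_k; a) · N_k(r_1,…,r_k; b) ≤ N_k^{(1)}(r_1,…,r_k; a,b) · N_k^{(1)}(r_1,…,r_k; b,a), where N_k^{(1)}(r_1,…,r_k; a,b) is the number of proper colourings of K(r_1,…,r_k) whose first part (of size r_1) is coloured with colours from A and whose remaining parts are coloured with colours from B, and N_k^{(1)}(r_1,…,r_k; b,a) is the number of proper colourings whose first part is coloured from B and whose remaining parts are coloured from A. -/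
open SimpleGraph

/-- The number of graph homomorphisms from `H` to `G`. -/
noncomputable def homCount {V W : Type} (H : SimpleGraph V) (G : SimpleGraph W) : ℕ :=
  Nat.card (H →g G)

/-- `N_k^{(1)}(r₁,…,r_k; A, B)`: the number of proper colourings of the complete
multipartite graph `K(r₁,…,r_k)` whose first part is coloured with colours from `A` and
whose remaining parts are coloured with colours from `B`. -/
noncomputable def N1 {k b : ℕ} (h0 : 0 < k) (r : Fin k → ℕ) (A B : Set (Fin b)) : ℕ :=
  Nat.card {f : (completeMultipartiteGraph fun i : Fin k => Fin (r i)) →g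
      completeGraph (Fin b) //
    ∀ v : Σ i : Fin k, Fin (r i),
      (v.1 = ⟨0, h0⟩ → f v ∈ A) ∧ (v.1 ≠ ⟨0, h0⟩ → f v ∈ B)}

namespace S18
open Finset
open scoped Classical

abbrev VV {k : ℕ} (r : Fin k → ℕ) := Σ i : Fin k, Fin (r i)
abbrev V0 {k : ℕ} (h0 : 0 < k) (r : Fin k → ℕ) := {v : VV r // v.1 = ⟨0, h0⟩}
abbrev V1 {k : ℕ} (h0 : 0 < k) (r : Fin k → ℕ) := {v : VV r // v.1 ≠ ⟨0, h0⟩}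
abbrev HR {k : ℕ} (h0 : 0 < k) (r : Fin k → ℕ) (b : ℕ) :=
  {h : V1 h0 r → Fin b // ∀ u v : V1 h0 r, u.1.1 ≠ v.1.1 → h u ≠ h v}

noncomputable def im {k : ℕ} {h0 : 0 < k} {r : Fin k → ℕ} {b : ℕ} (h : HR h0 r b) :
    Finset (Fin b) := univ.image h.1

noncomputable def eqv {k b : ℕ} (h0 : 0 < k) (r : Fin k → ℕ) (S T : Finset (Fin b)) :
    {f : (completeMultipartiteGraph fun i : Fin k => Fin (r i)) →g
      completeGraph (Fin b) //
    ∀ v : Σ i : Fin k, Fin (r i),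
      (v.1 = ⟨0, h0⟩ → f v ∈ (S : Set (Fin b))) ∧ (v.1 ≠ ⟨0, h0⟩ → f v ∈ (T : Set (Fin b)))} ≃
    Σ h : {h : HR h0 r b // im h ⊆ T}, (V0 h0 r → {c // c ∈ S \ im h.1}) where
  toFun f := ⟨⟨⟨fun v => f.1 v.1, fun u v huv => f.1.map_rel (a := u.1) (b := v.1) huv⟩, by
      intro c hc
      simp only [im, mem_image] at hc
      obtain ⟨v, -, rfl⟩ := hc
      exact (f.2 v.1).2 v.2⟩,
    fun v => ⟨f.1 v.1, by
      rw [mem_sdiff]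
      refine ⟨(f.2 v.1).1 v.2, ?_⟩
      simp only [im, mem_image]
      rintro ⟨u, -, hu⟩
      have : v.1.1 ≠ u.1.1 := by rw [v.2]; exact u.2.symm
      exact f.1.map_rel (a := v.1) (b := u.1) this hu.symm⟩⟩
  invFun p := ⟨⟨fun v => if hv : v.1 = ⟨0, h0⟩ then (p.2 ⟨v, hv⟩).1 else p.1.1.1 ⟨v, hv⟩, by
      intro u v huv
      have huv : u.1 ≠ v.1 := huv
      have key : ∀ (x : V0 h0 r) (y : V1 h0 r), (p.2 x).1 ≠ p.1.1.1 y := by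
        intro x y e
        have := (p.2 x).2
        rw [mem_sdiff] at this
        exact this.2 (by rw [e]; exact mem_image_of_mem _ (mem_univ _))
      show _ ≠ _
      by_cases hu : u.1 = ⟨0, h0⟩ <;> by_cases hv : v.1 = ⟨0, h0⟩
      · exact absurd (hu.trans hv.symm) huv
      · simp only [hu, hv, dif_pos, dif_neg, not_false_iff]; exact key _ _
      · simp only [hu, hv, dif_pos, dif_neg, not_false_iff]; exact (key _ _).symm
      · simp only [hu, hv, dif_neg, not_false_iff]; exact p.1.1.2 _ _ huv⟩, by
      intro v
      constructor
      · intro hv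
        show (dite _ _ _) ∈ _
        rw [dif_pos hv]
        exact (mem_sdiff.1 (p.2 ⟨v, hv⟩).2).1
      · intro hv
        show (dite _ _ _) ∈ _
        rw [dif_neg hv]
        exact p.1.2 (mem_image_of_mem _ (mem_univ _))⟩
  left_inv f := by
    apply Subtype.ext
    apply RelHom.ext
    intro v
    show (dite _ _ _) = _
    split_ifs <;> rfl
  right_inv p := by
    obtain ⟨⟨⟨h, hh⟩, hT⟩, g⟩ := p
    have e1 : (fun v : V1 h0 r => if hv : v.1.1 = ⟨0, h0⟩ then (g ⟨v.1, hv⟩).1 else h ⟨v.1, hv⟩) = h := by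
      funext v
      rw [dif_neg v.2]
    refine Sigma.ext (Subtype.ext (Subtype.ext e1)) ?_
    refine Function.hfunext rfl ?_
    intro v v' hv
    obtain rfl := eq_of_heq hv
    rw [Subtype.heq_iff_coe_eq]
    · show (dite _ _ _) = _
      rw [dif_pos v.2]
    · intro x
      show x ∈ S \ univ.image (fun v : V1 h0 r => if hv : v.1.1 = ⟨0, h0⟩ then (g ⟨v.1, hv⟩).1 else h ⟨v.1, hv⟩) ↔ x ∈ S \ univ.image h
      rw [e1]

theorem N1_eq {k b : ℕ} (h0 : 0 < k) (r : Fin k → ℕ) (S T : Finset (Fin b)) :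
    N1 h0 r (S : Set (Fin b)) (T : Set (Fin b)) =
      ∑ h : {h : HR h0 r b // im h ⊆ T}, (#(S \ im h.1)) ^ (Fintype.card (V0 h0 r)) := by
  unfold N1
  rw [Nat.card_congr (eqv h0 r S T), Nat.card_eq_fintype_card, Fintype.card_sigma]
  refine Fintype.sum_congr _ _ fun h => ?_
  rw [Fintype.card_fun, Fintype.card_coe]

theorem tangent (n : ℕ) (x y : ℝ) (hx : 0 ≤ x) (hy : 0 ≤ y) :
    y ^ (n+1) + (n+1) * y ^ n * (x - y) ≤ x ^ (n+1) := by
  induction n with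
  | zero => simp
  | succ n ih =>
    have h1 := mul_le_mul_of_nonneg_left ih hx
    have h2 : 0 ≤ (n+1) * y ^ n * (x-y)^2 := by positivity
    push_cast
    calc _ ≤ x * (y ^ (n+1) + (n+1) * y ^ n * (x - y)) := by
            have : x * (y ^ (n+1) + (n+1) * y ^ n * (x - y)) =
              (y ^ (n+1+1) + (n+1+1) * y ^ (n+1) * (x - y)) + (n+1) * y ^ n * (x-y)^2 := by ring
            linarith
      _ ≤ _ := by rw [pow_succ' x (n+1)]; exact h1

def act {k : ℕ} {h0 : 0 < k} {r : Fin k → ℕ} {b : ℕ} (σ : Equiv.Perm (Fin b)) :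
    HR h0 r b ≃ HR h0 r b where
  toFun h := ⟨fun v => σ (h.1 v), fun u v huv e => h.2 u v huv (σ.injective e)⟩
  invFun h := ⟨fun v => σ.symm (h.1 v), fun u v huv e => h.2 u v huv (σ.symm.injective e)⟩
  left_inv h := by apply Subtype.ext; funext v; simp
  right_inv h := by apply Subtype.ext; funext v; simp

theorem im_act {k : ℕ} {h0 : 0 < k} {r : Fin k → ℕ} {b : ℕ} (σ : Equiv.Perm (Fin b))
    (h : HR h0 r b) : im (act σ h) = (im h).image σ := by
  unfold im; rw [image_image]; rfl

theorem symm_sum {k : ℕ} {h0 : 0 < k} {r : Fin k → ℕ} {b : ℕ} (φ : ℕ → ℝ) (c d : Fin b) :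
    ∑ h : HR h0 r b, (if c ∈ im h then φ #(im h) else 0) =
    ∑ h : HR h0 r b, (if d ∈ im h then φ #(im h) else 0) := by
  refine Fintype.sum_equiv (act (Equiv.swap c d)) _ _ fun h => ?_
  rw [im_act, card_image_of_injective _ (Equiv.injective _)]
  have : d ∈ (im h).image (Equiv.swap c d) ↔ c ∈ im h := by
    constructor
    · intro hd
      obtain ⟨x, hx, e⟩ := mem_image.1 hd
      have : x = c := by
        apply (Equiv.swap c d).injective; rw [e, Equiv.swap_apply_left]
      exact this ▸ hx
    · intro hc
      exact mem_image.2 ⟨c, hc, Equiv.swap_apply_left _ _⟩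
  simp only [this]

theorem inter_sum {k : ℕ} {h0 : 0 < k} {r : Fin k → ℕ} {b : ℕ} (φ : ℕ → ℝ) (c : Fin b)
    (S : Finset (Fin b)) :
    ∑ h : HR h0 r b, φ #(im h) * (#(S ∩ im h) : ℝ) =
    #S * ∑ h : HR h0 r b, (if c ∈ im h then φ #(im h) else 0) := by
  have : ∀ h : HR h0 r b, φ #(im h) * (#(S ∩ im h) : ℝ) =
      ∑ x ∈ S, if x ∈ im h then φ #(im h) else 0 := by
    intro h
    rw [← sum_filter, sum_const, filter_mem_eq_inter, nsmul_eq_mul, mul_comm]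
  simp only [this]
  rw [sum_comm, sum_congr rfl (fun x _ => symm_sum φ x c), sum_const, nsmul_eq_mul]

theorem main1 {k b : ℕ} (h0 : 0 < k) (r : Fin k → ℕ) (hb : 0 < b) (S : Finset (Fin b)) (n : ℕ) :
    (∑ h : HR h0 r b, (#(univ \ im h)) ^ n) * (#S) ^ n ≤
    (∑ h : HR h0 r b, (#(S \ im h)) ^ n) * b ^ n := by
  cases n with
  | zero => simp
  | succ n =>
  rw [sum_mul, sum_mul]
  simp only [← mul_pow]
  have e1 : ∀ h : HR h0 r b, (#(univ \ im h) : ℝ) = b - #(im h) := by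
    intro h
    have := card_sdiff_add_card_inter univ (im h)
    rw [univ_inter, card_univ, Fintype.card_fin] at this
    rw [eq_sub_iff_add_eq]; exact_mod_cast this
  have e2 : ∀ h : HR h0 r b, (#(S \ im h) : ℝ) = #S - #(S ∩ im h) := by
    intro h
    have := card_sdiff_add_card_inter S (im h)
    rw [eq_sub_iff_add_eq]; exact_mod_cast this
  let φ : ℕ → ℝ := fun m => (n+1) * ((b - m) * #S) ^ n
  have z1 := inter_sum (h0 := h0) (r := r) φ ⟨0, hb⟩ S
  have z2 := inter_sum (h0 := h0) (r := r) φ ⟨0, hb⟩ univ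
  simp only [univ_inter, card_univ, Fintype.card_fin] at z2
  have z : ∑ h : HR h0 r b, φ #(im h) * ((#(S \ im h) : ℝ) * b - (#(univ \ im h) : ℝ) * #S) = 0 := by
    have : ∀ h : HR h0 r b, φ #(im h) * ((#(S \ im h) : ℝ) * b - (#(univ \ im h) : ℝ) * #S) =
        #S * (φ #(im h) * (#(im h) : ℝ)) - b * (φ #(im h) * (#(S ∩ im h) : ℝ)) := by
      intro h; rw [e1, e2]; ring
    simp only [this]
    rw [sum_sub_distrib, ← mul_sum, ← mul_sum, z1, z2]; ring
  have t : ∀ h : HR h0 r b, ((#(univ \ im h) : ℝ) * #S) ^ (n+1) +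
      φ #(im h) * ((#(S \ im h) : ℝ) * b - (#(univ \ im h) : ℝ) * #S) ≤
      ((#(S \ im h) : ℝ) * b) ^ (n+1) := by
    intro h
    have := tangent n ((#(S \ im h) : ℝ) * b) ((#(univ \ im h) : ℝ) * #S) 
      (mul_nonneg (Nat.cast_nonneg _) (Nat.cast_nonneg _)) (mul_nonneg (Nat.cast_nonneg _) (Nat.cast_nonneg _))
    simp only [φ]
    rw [← e1]
    exact this
  have s := sum_le_sum (s := univ) fun h _ => t h
  rw [sum_add_distrib, z, add_zero] at s
  exact_mod_cast s

theorem main2 {k b : ℕ} (h0 : 0 < k) (r : Fin k → ℕ) (S : Finset (Fin b)) (n : ℕ) :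
    (∑ h : {h : HR h0 r b // im h ⊆ S}, (#(S \ im h.1)) ^ n) * b ^ n ≤
    (∑ h : {h : HR h0 r b // im h ⊆ S}, (#(univ \ im h.1)) ^ n) * (#S) ^ n := by
  rw [sum_mul, sum_mul]
  simp only [← mul_pow]
  refine sum_le_sum fun h _ => Nat.pow_le_pow_left ?_ n
  have e1 := card_sdiff_add_card_eq_card h.2
  have e2 := card_sdiff_add_card_eq_card (subset_univ (im h.1))
  rw [card_univ, Fintype.card_fin] at e2
  have e3 : #S ≤ b := by simpa using card_le_univ S
  rw [← e1] at e3 ⊢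
  set x := #(S \ im h.1)
  set y := #(univ \ im h.1)
  set m := #(im h.1)
  rw [← e2] at e3 ⊢
  have : x ≤ y := by omega
  nlinarith [Nat.mul_le_mul_right m this]

theorem hom_eq {k b : ℕ} (h0 : 0 < k) (r : Fin k → ℕ) (a : ℕ) (S : Finset (Fin b)) (hS : #S = a) :
    homCount (completeMultipartiteGraph fun i : Fin k => Fin (r i)) (completeGraph (Fin a)) =
      N1 h0 r (S : Set (Fin b)) (S : Set (Fin b)) := by
  let e : Fin a ≃ {c // c ∈ S} := (S.equivFinOfCardEq hS).symm
  refine Nat.card_congr ⟨fun f => ⟨⟨fun v => (e (f v)).1, ?_⟩, ?_⟩,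
    fun f => ⟨fun v => e.symm ⟨f.1 v, ?_⟩, ?_⟩, ?_, ?_⟩
  · intro u v huv he
    exact f.map_rel huv (e.injective (Subtype.ext he))
  · intro v
    exact ⟨fun _ => (e (f v)).2, fun _ => (e (f v)).2⟩
  · by_cases hv : v.1 = ⟨0, h0⟩
    · exact (f.2 v).1 hv
    · exact (f.2 v).2 hv
  · intro u v huv he
    exact f.1.map_rel huv (congrArg Subtype.val (e.symm.injective he))
  · intro f
    apply RelHom.ext
    intro v
    exact e.symm_apply_apply _
  · intro f
    apply Subtype.ext
    apply RelHom.ext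
    intro v
    exact congrArg Subtype.val (e.apply_symm_apply _)

theorem sum_univ {k b : ℕ} (h0 : 0 < k) (r : Fin k → ℕ) (F : HR h0 r b → ℕ) :
    ∑ h : {h : HR h0 r b // im h ⊆ univ}, F h.1 = ∑ h : HR h0 r b, F h :=
  Fintype.sum_equiv (Equiv.subtypeUnivEquiv fun _ => subset_univ _) _ _ fun _ => rfl

theorem final {k b a : ℕ} (h0 : 0 < k) (r : Fin k → ℕ) (ha : 1 ≤ a) (hab : a ≤ b)
    (S : Finset (Fin b)) (hS : #S = a) :
    homCount (completeMultipartiteGraph fun i : Fin k => Fin (r i)) (completeGraph (Fin a)) *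
    homCount (completeMultipartiteGraph fun i : Fin k => Fin (r i)) (completeGraph (Fin b)) ≤
    N1 h0 r (S : Set (Fin b)) ((univ : Finset (Fin b)) : Set (Fin b)) *
      N1 h0 r ((univ : Finset (Fin b)) : Set (Fin b)) (S : Set (Fin b)) := by
  rw [hom_eq h0 r a S hS, hom_eq h0 r b (univ : Finset (Fin b)) (by simp), N1_eq, N1_eq, N1_eq, N1_eq,
    sum_univ h0 r (fun h => #(univ \ im h) ^ _), sum_univ h0 r (fun h => #(S \ im h) ^ _)]
  set n := Fintype.card (V0 h0 r)
  have m1 := main1 h0 r (by omega) S n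
  have m2 := main2 h0 r S n
  rw [hS] at m1 m2
  have hp : 0 < a ^ n * b ^ n := by
    have : 0 < b := by omega
    positivity
  refine Nat.le_of_mul_le_mul_right ?_ hp
  have := Nat.mul_le_mul m1 m2
  refine le_trans (le_of_eq ?_) (this.trans (le_of_eq ?_)) <;> ring

end S18

/-- For `1 ≤ a ≤ b`, `k ≥ 2`, positive part sizes `r₁,…,r_k` and nested
colour sets `A ⊆ B ⊆ [b]` with `|A| = a`, `|B| = b`,
`N_k(r;a) ⬝ N_k(r;b) ≤ N_k^{(1)}(r;a,b) ⬝ N_k^{(1)}(r;b,a)`. -/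
theorem stmt18 {a b k : ℕ} (ha : 1 ≤ a) (hab : a ≤ b) (hk : 2 ≤ k)
    (r : Fin k → ℕ) (hr : ∀ i, 1 ≤ r i)
    (A B : Set (Fin b)) (hAB : A ⊆ B) (hcardA : A.ncard = a) (hcardB : B.ncard = b) :
    homCount (completeMultipartiteGraph fun i : Fin k => Fin (r i))
        (completeGraph (Fin a)) *
      homCount (completeMultipartiteGraph fun i : Fin k => Fin (r i))
        (completeGraph (Fin b)) ≤
    N1 (by omega) r A B * N1 (by omega) r B A := by
  have hB : B = Set.univ := by
    apply Set.eq_of_subset_of_ncard_le (Set.subset_univ _)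
    rw [hcardB, Set.ncard_univ, Nat.card_fin]
  classical
  subst hB
  have := S18.final (k := k) (by omega) r ha hab A.toFinset
    (by rw [← Set.ncard_eq_toFinset_card', hcardA])
  simpa only [Set.coe_toFinset, Finset.coe_univ] using this
end

section
/- Let k ≥ 2, let a ≥ k be an integer, and let r_i, s_i (1 ≤ i ≤ k) be nonnegative integers with r_i ≤ s_i for all i. Then N_k(s_1,…,s_k; a) · N_k(r_1,…,r_k; a) ≤ N_k(s_1, r_2, …, r_k; a) · N_k(r_1, s_2, …, s_k; a). -/
open SimpleGraph

/-- `N_k(r₁,…,r_k; a)`: the number of proper colourings of the complete multipartite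
graph `K(r₁,…,r_k)` with `a` colours, i.e. `hom(K(r₁,…,r_k), K_a)`. -/
noncomputable def Nk {k : ℕ} (r : Fin k → ℕ) (a : ℕ) : ℕ :=
  homCount (completeMultipartiteGraph fun i => Fin (r i)) (completeGraph (Fin a))

lemma comp_aux (F : Finset ℕ) (K1 K2 L1 L2 : ℕ → ℕ)
    (hK : ∀ m m', m ≤ m' → K1 m' * K2 m ≤ K1 m * K2 m')
    (hL : ∀ m m', m ≤ m' → L1 m * L2 m' ≤ L1 m' * L2 m) :
    (∑ m ∈ F, K1 m * L1 m) * (∑ m ∈ F, K2 m * L2 m) ≤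
      (∑ m ∈ F, K1 m * L2 m) * (∑ m ∈ F, K2 m * L1 m) := by
  have key : ∀ A B C D : ℕ → ℕ, 2 * ((∑ m ∈ F, A m * B m) * (∑ m ∈ F, C m * D m)) =
      ∑ m ∈ F, ∑ m' ∈ F, (A m * B m * (C m' * D m') + A m' * B m' * (C m * D m)) := by
    intro A B C D
    simp only [Finset.sum_add_distrib]
    rw [Finset.sum_comm (f := fun m m' => A m' * B m' * (C m * D m)), Finset.sum_mul_sum]
    ring
  have : 2 * ((∑ m ∈ F, K1 m * L1 m) * (∑ m ∈ F, K2 m * L2 m)) ≤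
      2 * ((∑ m ∈ F, K1 m * L2 m) * (∑ m ∈ F, K2 m * L1 m)) := by
    rw [key, key]
    refine Finset.sum_le_sum fun m _ => Finset.sum_le_sum fun m' _ => ?_
    have gen : ∀ m m', m ≤ m' → K1 m * L1 m * (K2 m' * L2 m') + K1 m' * L1 m' * (K2 m * L2 m) ≤
        K1 m * L2 m * (K2 m' * L1 m') + K1 m' * L2 m' * (K2 m * L1 m) := by
      intro m m' h
      have h1 := hK m m' h
      have h2 := hL m m' h
      zify at *
      nlinarith [mul_nonneg (sub_nonneg.2 h1) (sub_nonneg.2 h2)]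
    rcases le_total m m' with h | h
    · exact gen m m' h
    · have := gen m' m h
      linarith
  omega

def SLC (u : ℕ → ℕ) : Prop := ∀ n d e, u n * u (n + d + e) ≤ u (n + d) * u (n + e)

lemma SLC_of_adj (f : ℕ → ℕ) (h : ∀ p q, p ≤ q → f p * f (q + 1) ≤ f (p + 1) * f q) : SLC f := by
  intro n d
  induction d generalizing n with
  | zero => intro e; simp
  | succ d ih =>
    intro e
    cases e with
    | zero => simp [mul_comm]
    | succ e =>
      have h1 := h n (n + d + e + 1) (by omega)
      have h2 := ih (n + 1) e
      have e1 : n + (d + 1) + (e + 1) = n + d + e + 1 + 1 := by ring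
      have e2 : n + 1 + d + e = n + d + e + 1 := by ring
      have e3 : n + 1 + d = n + (d + 1) := by ring
      have e4 : n + 1 + e = n + (e + 1) := by ring
      rw [e1]
      rw [e2, e3, e4] at h2
      exact h1.trans h2

lemma stir_SLC (r : ℕ) : SLC (Nat.stirlingSecond r) := by
  induction r with
  | zero =>
    apply SLC_of_adj
    intro p q h
    simp [Nat.stirlingSecond]
  | succ r ih =>
    apply SLC_of_adj
    intro p q h
    rcases p with _ | P
    · simp [Nat.stirlingSecond]
    obtain ⟨Q, rfl⟩ : ∃ Q, q = Q + 1 := ⟨q - 1, by omega⟩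
    have hPQ : P ≤ Q := by omega
    simp only [Nat.stirlingSecond]
    set f := Nat.stirlingSecond r
    obtain ⟨t, rfl⟩ := Nat.exists_eq_add_of_le hPQ
    have h1 : f (P+1) * f (P+t+2) ≤ f (P+2) * f (P+t+1) := by
      have := ih (P+1) 1 t
      convert this using 3 <;> ring
    have h2 : f P * f (P+t+1) ≤ f (P+1) * f (P+t) := by
      have := ih P 1 t
      convert this using 3; ring
    have h3 : f P * f (P+t+2) ≤ f (P+1) * f (P+t+1) := by
      have := ih P 1 (t+1)
      convert this using 3 <;> ring
    have h4 : (P+1) * (f (P+1) * f (P+t+1)) + (P+t+2) * (f P * f (P+t+2)) ≤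
        (P+2) * (f (P+2) * f (P+t)) + (P+t+1) * (f (P+1) * f (P+t+1)) := by
      rcases t with _ | t
      · simp only [add_zero]
        apply le_of_eq
        ring
      · have : f (P+1) * f (P+(t+1)+1) ≤ f (P+2) * f (P+(t+1)) := by
          have := ih (P+1) 1 t
          convert this using 3 <;> ring
        have h4' := Nat.mul_le_mul_left (P+2) this
        have h3' := Nat.mul_le_mul_left (P+(t+1)+2) h3
        nlinarith
    have e : P + t + 1 + 1 = P + t + 2 := by ring
    have e' : P + 1 + 1 = P + 2 := by ring
    simp only [e, e']
    have h1' := Nat.mul_le_mul_left ((P+1)*(P+t+2)) h1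
    have : (P+1)*(P+t+2) ≤ (P+2)*(P+t+1) := by nlinarith
    have h5 := Nat.mul_le_mul_right (f (P+2) * f (P+t+1)) this
    nlinarith

lemma stir_TP (x x' m m' : ℕ) (hx : x ≤ x') (hm : m ≤ m') :
    Nat.stirlingSecond x m' * Nat.stirlingSecond x' m ≤
      Nat.stirlingSecond x m * Nat.stirlingSecond x' m' := by
  induction x generalizing x' m m' with
  | zero =>
    rcases m' with _ | q
    · obtain rfl : m = 0 := by omega
      exact le_rfl
    · simp [Nat.stirlingSecond]
  | succ x ih =>
    obtain ⟨y, rfl⟩ : ∃ y, x' = y + 1 := ⟨x' - 1, by omega⟩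
    have hxy : x ≤ y := by omega
    rcases m with _ | p
    · simp [Nat.stirlingSecond]
    obtain ⟨q, rfl⟩ : ∃ q, m' = q + 1 := ⟨m' - 1, by omega⟩
    have hpq : p ≤ q := by omega
    simp only [Nat.stirlingSecond]
    have h1 := Nat.mul_le_mul_left ((p+1)*(q+1)) (ih y (p+1) (q+1) hxy hm)
    have h2 := ih y p q hxy hpq
    have h4 : (q+1) * (x.stirlingSecond (q+1) * y.stirlingSecond p) +
        (p+1) * (x.stirlingSecond q * y.stirlingSecond (p+1)) ≤
        (q+1) * (x.stirlingSecond p * y.stirlingSecond (q+1)) +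
        (p+1) * (x.stirlingSecond (p+1) * y.stirlingSecond q) := by
      rcases hpq.eq_or_lt with rfl | h
      · apply le_of_eq
        ring
      · exact Nat.add_le_add (Nat.mul_le_mul_left (q+1) (ih y p (q+1) hxy (by omega)))
          (Nat.mul_le_mul_left _ (ih y (p+1) q hxy h))
    nlinarith

def EE (r : ℕ) (u : ℕ → ℕ) : ℕ → ℕ :=
  fun n => ∑ m ∈ Finset.range (r + 1), Nat.stirlingSecond r m * u (n + m)

lemma EE_eq (r M : ℕ) (h : r + 1 ≤ M) (u : ℕ → ℕ) (n : ℕ) :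
    EE r u n = ∑ m ∈ Finset.range M, Nat.stirlingSecond r m * u (n + m) := by
  unfold EE
  apply Finset.sum_subset
  · intro m; simp only [Finset.mem_range]; omega
  · intro m _ hm
    rw [Nat.stirlingSecond_eq_zero_of_lt (by simpa using hm), zero_mul]

lemma EE_toep (r M : ℕ) (u : ℕ → ℕ) (n d : ℕ) (h : n + r + 1 ≤ M) :
    EE r u (n + d) = ∑ l ∈ Finset.range M,
      (if n ≤ l then Nat.stirlingSecond r (l - n) else 0) * u (l + d) := by
  obtain ⟨t, rfl⟩ := Nat.exists_eq_add_of_le (show n ≤ M by omega)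
  rw [EE_eq r t (by omega), Finset.sum_range_add, Finset.sum_eq_zero (s := Finset.range n), zero_add]
  · refine Finset.sum_congr rfl fun m _ => ?_
    simp
    left
    congr 1
    ring
  · intro m hm
    rw [if_neg (by simpa using hm), zero_mul]

lemma EE_SLC (r : ℕ) (u : ℕ → ℕ) (hu : SLC u) : SLC (EE r u) := by
  intro n d e
  have e1 : n + d + e = (n + e) + d := by ring
  have e2 := EE_toep r (n + e + r + 1) u n 0 (by omega)
  have e3 := EE_toep r (n + e + r + 1) u (n + e) 0 (by omega)
  rw [add_zero] at e2 e3
  rw [e1, e2, e3, EE_toep r (n + e + r + 1) u n d (by omega),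
    EE_toep r (n + e + r + 1) u (n + e) d (by omega)]
  apply comp_aux
  · intro m m' h
    by_cases h1 : n + e ≤ m
    · obtain ⟨x, rfl⟩ := Nat.exists_eq_add_of_le h1
      obtain ⟨y, rfl⟩ := Nat.exists_eq_add_of_le h
      rw [if_pos (by omega), if_pos (by omega), if_pos (by omega), if_pos (by omega)]
      have := stir_SLC r x e y
      rw [mul_comm]
      convert this using 3 <;> omega
    · simp [h1]
  · intro m m' h
    obtain ⟨y, rfl⟩ := Nat.exists_eq_add_of_le h
    have := hu m y d
    rw [add_zero, add_zero]
    exact this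

lemma EE_step (z z' : ℕ) (h : z ≤ z') (u : ℕ → ℕ) (hu : SLC u) (m m' : ℕ) (hm : m ≤ m') :
    EE z u m * EE z' u m' ≤ EE z u m' * EE z' u m := by
  rw [EE_eq z (z' + 1) (by omega), EE_eq z (z' + 1) (by omega), EE_eq z' (z' + 1) (by omega),
    EE_eq z' (z' + 1) (by omega)]
  apply comp_aux
  · intro p q hpq
    exact stir_TP z z' p q h hpq
  · intro p q hpq
    obtain ⟨t, rfl⟩ := Nat.exists_eq_add_of_le hm
    obtain ⟨y, rfl⟩ := Nat.exists_eq_add_of_le hpq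
    have := hu (m + p) y t
    convert this using 3 <;> ring

lemma EE_two (x x' z z' : ℕ) (hx : x ≤ x') (h : z ≤ z') (u : ℕ → ℕ) (hu : SLC u) :
    EE x' (EE z' u) 0 * EE x (EE z u) 0 ≤ EE x' (EE z u) 0 * EE x (EE z' u) 0 := by
  rw [mul_comm, mul_comm (EE x' (EE z u) 0)]
  simp only [EE_eq x (x' + 1) (by omega), EE_eq x' (x' + 1) le_rfl]
  apply comp_aux
  · intro p q hpq
    exact stir_TP x x' p q hx hpq
  · intro p q hpq
    exact EE_step z z' h u hu _ _ (by omega)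

lemma EE_comm (x z : ℕ) (u : ℕ → ℕ) : EE x (EE z u) = EE z (EE x u) := by
  funext n
  simp only [EE, Finset.mul_sum]
  rw [Finset.sum_comm]
  refine Finset.sum_congr rfl fun m _ => Finset.sum_congr rfl fun l _ => ?_
  rw [add_right_comm]
  ring

instance : LeftCommutative EE := ⟨EE_comm⟩

lemma desc_add (a n m : ℕ) :
    a.descFactorial (n + m) = a.descFactorial n * (a - n).descFactorial m := by
  induction m with
  | zero => simp
  | succ m ih =>
    rw [← add_assoc, Nat.descFactorial_succ, ih, Nat.descFactorial_succ, Nat.sub_sub]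
    ring

lemma desc_SLC (a : ℕ) : SLC (fun n => a.descFactorial n) := by
  intro n d e
  simp only [desc_add]
  have : (a - (n + d)).descFactorial e ≤ (a - n).descFactorial e :=
    Nat.descFactorial_le _ (by omega)
  calc _ = (a.descFactorial n * (a - n).descFactorial d * a.descFactorial n) * (a - (n + d)).descFactorial e := by ring
    _ ≤ (a.descFactorial n * (a - n).descFactorial d * a.descFactorial n) * (a - n).descFactorial e :=
      Nat.mul_le_mul_left _ this
    _ = _ := by ring

def WW (a : ℕ) (s : Multiset ℕ) : ℕ → ℕ := s.foldr EE (fun n => a.descFactorial n)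

lemma WW_SLC (a : ℕ) (s : Multiset ℕ) : SLC (WW a s) := by
  induction s using Multiset.induction with
  | empty => exact desc_SLC a
  | cons r s ih =>
    simp only [WW, Multiset.foldr_cons]
    exact EE_SLC _ _ ih

lemma sum_im (r : ℕ) {α : Type} [Fintype α] [DecidableEq α] (G : ℕ → ℕ) :
    ∑ f : Fin r → α, G (Finset.univ.image f).card =
      ∑ m ∈ Finset.range (r + 1), Nat.stirlingSecond r m *
        ((Fintype.card α).descFactorial m * G m) := by
  induction r generalizing G with
  | zero => simp
  | succ r ih =>
    rw [← (Fin.consEquiv (fun _ => α)).sum_comp, Fintype.sum_prod_type, Finset.sum_comm]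
    have : ∀ f : Fin r → α, ∑ c : α, G (Finset.univ.image (Fin.consEquiv (fun _ => α) (c, f))).card
        = (fun m => m * G m + (Fintype.card α - m) * G (m + 1)) (Finset.univ.image f).card := by
      intro f
      have h1 : ∀ c : α, G (Finset.univ.image (Fin.consEquiv (fun _ => α) (c, f))).card =
          if c ∈ Finset.univ.image f then G (Finset.univ.image f).card
          else G ((Finset.univ.image f).card + 1) := by
        intro c
        have : Finset.univ.image (Fin.consEquiv (fun _ => α) (c, f)) =
            insert c (Finset.univ.image f) := by
          ext x
          simp [Fin.exists_fin_succ, eq_comm]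
        rw [this]
        split_ifs with hc
        · rw [Finset.insert_eq_of_mem hc]
        · rw [Finset.card_insert_of_notMem hc]
      simp only [h1]
      rw [Finset.sum_ite]
      simp only [Finset.sum_const, smul_eq_mul]
      congr 2
      · congr 1; ext; simp
      · rw [← Finset.card_compl]; congr 1; ext; simp
    rw [Finset.sum_congr rfl fun f _ => this f,
      ih (fun m => m * G m + (Fintype.card α - m) * G (m + 1))]
    rw [Finset.sum_range_succ' _ (r + 1)]
    have e1 : ∑ m ∈ Finset.range (r + 1), r.stirlingSecond m *
        ((Fintype.card α).descFactorial m * (m * G m)) =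
        ∑ m ∈ Finset.range (r + 1), r.stirlingSecond (m+1) *
        ((Fintype.card α).descFactorial (m+1) * ((m+1) * G (m+1))) := by
      rw [Finset.sum_range_succ', Finset.sum_range_succ _ r, Nat.stirlingSecond_eq_zero_of_lt (Nat.lt_succ_self r)]
      simp
    simp only [mul_add, Finset.sum_add_distrib]
    rw [e1, ← Finset.sum_add_distrib]
    simp only [Nat.stirlingSecond, zero_mul, add_zero]
    refine Finset.sum_congr rfl fun m _ => ?_
    rw [Nat.descFactorial_succ]
    ring

abbrev HH {k : ℕ} (r : Fin k → ℕ) (α : Type) :=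
  (completeMultipartiteGraph fun i => Fin (r i)) →g (completeGraph α)

def HH_congr {k : ℕ} (r : Fin k → ℕ) {α β : Type} (e : α ≃ β) : HH r α ≃ HH r β where
  toFun g := ⟨fun v => e (g v), fun {v w} h => fun h' => g.map_rel h (e.injective h')⟩
  invFun g := ⟨fun v => e.symm (g v), fun {v w} h => fun h' => g.map_rel h (e.symm.injective h')⟩
  left_inv g := by ext; simp
  right_inv g := by ext; simp

def HH_split {k : ℕ} (r : Fin (k+1) → ℕ) (α : Type) :
    HH r α ≃ (Σ f : Fin (r 0) → α, HH (fun i : Fin k => r i.succ) {c : α // ∀ x, f x ≠ c}) where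
  toFun g := ⟨fun x => g ⟨0, x⟩, ⟨fun v => ⟨g ⟨v.1.succ, v.2⟩, fun x =>
      g.map_rel (a := ⟨0, x⟩) (b := ⟨v.1.succ, v.2⟩) (Fin.succ_ne_zero _).symm⟩, by
      intro v w h h'
      have h' := congrArg Subtype.val h'
      exact g.map_rel (a := ⟨v.1.succ, v.2⟩) (b := ⟨w.1.succ, w.2⟩)
        (fun h2 => h (Fin.succ_injective _ h2)) h'⟩⟩
  invFun p := ⟨fun v => Fin.cases (motive := fun i => Fin (r i) → α) p.1
      (fun i x => (p.2 ⟨i, x⟩ : α)) v.1 v.2, by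
      rintro ⟨i, x⟩ ⟨j, y⟩ h h'
      revert x y
      refine Fin.cases ?_ (fun i => ?_) i <;> refine Fin.cases ?_ (fun j => ?_) j
      · intro x y h; exact absurd rfl h
      · intro x y h h'
        exact (p.2 ⟨j, y⟩).2 x h'
      · intro x y h h'
        exact (p.2 ⟨i, x⟩).2 y h'.symm
      · intro x y h h'
        exact p.2.map_rel (a := ⟨i, x⟩) (b := ⟨j, y⟩)
          (fun h2 => h (congrArg Fin.succ h2)) (Subtype.ext h')⟩
  left_inv g := by
    ext ⟨i, x⟩
    revert x
    refine Fin.cases ?_ (fun i => ?_) i <;> intro x <;> rfl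
  right_inv p := by
    rfl

instance HH_fin {k : ℕ} (r : Fin k → ℕ) (α : Type) [Finite α] : Finite (HH r α) :=
  Finite.of_injective (fun g => (g : _ → α)) DFunLike.coe_injective

lemma HH_card {k : ℕ} (r : Fin k → ℕ) (α : Type) [Fintype α] :
    Nat.card (HH r α) = Nk r (Fintype.card α) :=
  Nat.card_congr (HH_congr r (Fintype.equivFin α))

lemma Nk_succ {k : ℕ} (r : Fin (k+1) → ℕ) (b : ℕ) :
    Nk r b = ∑ m ∈ Finset.range (r 0 + 1), Nat.stirlingSecond (r 0) m *
        (b.descFactorial m * Nk (fun i : Fin k => r i.succ) (b - m)) := by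
  classical
  have := sum_im (r 0) (α := Fin b) (fun m => Nk (fun i : Fin k => r i.succ) (b - m))
  rw [Fintype.card_fin] at this
  rw [← this]
  change Nat.card (HH r (Fin b)) = _
  rw [Nat.card_congr (HH_split r (Fin b)), Nat.card_sigma]
  refine Finset.sum_congr rfl fun f _ => ?_
  rw [HH_card]
  congr 1
  rw [Fintype.card_subtype]
  have hc := Finset.card_compl (Finset.univ.image f)
  rw [Fintype.card_fin] at hc
  rw [← hc]
  congr 1
  ext; simp

lemma Nk_eq_WW {k : ℕ} (r : Fin k → ℕ) (a n : ℕ) :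
    a.descFactorial n * Nk r (a - n) = WW a (Finset.univ.val.map r) n := by
  induction k generalizing n with
  | zero =>
    have : Nk r (a - n) = 1 := by
      unfold Nk homCount
      rw [Nat.card_eq_one_iff_unique]
      refine ⟨⟨fun g h => ?_⟩, ⟨⟨fun v => v.1.elim0, fun {v} => v.1.elim0⟩⟩⟩
      ext v; exact v.1.elim0
    rw [this]
    simp [WW]
  | succ k ih =>
    have : (Finset.univ.val.map r : Multiset ℕ) =
        r 0 ::ₘ (Finset.univ.val.map (fun i : Fin k => r i.succ)) := by
      rw [Fin.univ_succ]
      simp [Function.comp_def]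
    rw [this, Nk_succ, WW, Multiset.foldr_cons]
    change _ = EE (r 0) (WW a _) n
    simp only [EE]
    rw [Finset.mul_sum]
    refine Finset.sum_congr rfl fun m _ => ?_
    rw [← ih, desc_add, Nat.sub_sub]
    ring

lemma Nk_two {k : ℕ} (i j : Fin k) (hij : i ≠ j) (y : Fin k → ℕ) (a : ℕ) (x x' z z' : ℕ)
    (hx : x ≤ x') (hz : z ≤ z') :
    Nk (Function.update (Function.update y j z') i x') a *
      Nk (Function.update (Function.update y j z) i x) a ≤
    Nk (Function.update (Function.update y j z) i x') a *
      Nk (Function.update (Function.update y j z') i x) a := by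
  have key : ∀ x z, Nk (Function.update (Function.update y j z) i x) a =
      EE x (EE z (WW a (((Finset.univ.erase i).erase j).val.map y))) 0 := by
    intro x z
    have h := Nk_eq_WW (Function.update (Function.update y j z) i x) a 0
    have h2 : (Finset.univ.val.map (Function.update (Function.update y j z) i x) : Multiset ℕ) =
        x ::ₘ z ::ₘ (((Finset.univ.erase i).erase j).val.map y) := by
      conv_lhs => rw [← Finset.insert_erase (Finset.mem_univ i),
        ← Finset.insert_erase (show j ∈ Finset.univ.erase i by simp [hij.symm])]
      rw [Finset.insert_val_of_notMem (by simp [hij]), Finset.insert_val_of_notMem (by simp)]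
      rw [Multiset.map_cons, Multiset.map_cons]
      simp only [Function.update_self, Function.update_of_ne hij.symm]
      congr 2
      refine Multiset.map_congr rfl fun l hl => ?_
      have hl : l ∈ (Finset.univ.erase i).erase j := hl
      simp at hl
      rw [Function.update_of_ne hl.2, Function.update_of_ne hl.1]
    rw [h2, WW, Multiset.foldr_cons, Multiset.foldr_cons] at h
    simpa [WW] using h
  simp only [key]
  exact EE_two x x' z z' hx hz _ (WW_SLC _ _)

lemma Nk_pos {k a : ℕ} (h : k ≤ a) (r : Fin k → ℕ) : 0 < Nk r a := by
  have : Nonempty (HH r (Fin a)) := ⟨⟨fun v => Fin.castLE h v.1, fun {v w} hvw h' =>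
    hvw (Fin.castLE_injective h h')⟩⟩
  have hf : Finite (HH r (Fin a)) := inferInstance
  exact Nat.card_pos (α := HH r (Fin a))

lemma Nk_main {k a : ℕ} (hka : k ≤ a) (i : Fin k) (r s : Fin k → ℕ) (hrs : ∀ i, r i ≤ s i)
    (T : Finset (Fin k)) (hT : i ∉ T) :
    Nk (Function.update (T.piecewise s r) i (s i)) a * Nk (Function.update r i (r i)) a ≤
      Nk (Function.update r i (s i)) a * Nk (Function.update (T.piecewise s r) i (r i)) a := by
  induction T using Finset.induction_on with
  | empty => simp
  | insert j T hj ih =>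
    have hij : i ≠ j := by rintro rfl; simp at hT
    have ih := ih (by simp at hT; tauto)
    have h2 := Nk_two i j hij (T.piecewise s r) a (r i) (s i) (r j) (s j) (hrs i) (hrs j)
    rw [← Finset.piecewise_insert] at h2
    have e : Function.update (T.piecewise s r) j (r j) = T.piecewise s r := by
      rw [Function.update_eq_self_iff]; simp [hj]
    rw [e] at h2
    have p1 := Nk_pos hka (Function.update (T.piecewise s r) i (r i))
    have p2 := Nk_pos hka (Function.update (T.piecewise s r) i (s i))
    have := Nat.mul_le_mul h2 ih
    refine Nat.le_of_mul_le_mul_left ?_ (Nat.mul_pos p1 p2)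
    nlinarith

/-- log-submodularity. For `k ≥ 2`, `a ≥ k` and nonnegative part sizes
`r_i ≤ s_i`,
`N_k(s₁,…,s_k;a) ⬝ N_k(r₁,…,r_k;a) ≤ N_k(s₁,r₂,…,r_k;a) ⬝ N_k(r₁,s₂,…,s_k;a)`. -/
theorem stmt19 {k a : ℕ} (hk : 2 ≤ k) (hka : k ≤ a)
    (r s : Fin k → ℕ) (hrs : ∀ i, r i ≤ s i) :
    Nk s a * Nk r a ≤
      Nk (Function.update r (⟨0, by omega⟩ : Fin k) (s ⟨0, by omega⟩)) a *
        Nk (Function.update s (⟨0, by omega⟩ : Fin k) (r ⟨0, by omega⟩)) a := by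
  have h := Nk_main hka ⟨0, by omega⟩ r s hrs (Finset.univ.erase ⟨0, by omega⟩) (by simp)
  have e : ∀ x, Function.update ((Finset.univ.erase (⟨0, by omega⟩ : Fin k)).piecewise s r)
      ⟨0, by omega⟩ x = Function.update s ⟨0, by omega⟩ x := by
    intro x
    funext l
    by_cases hl : l = ⟨0, by omega⟩
    · subst hl; simp
    · rw [Function.update_of_ne hl, Function.update_of_ne hl]
      simp [hl]
  rw [e, e, Function.update_eq_self, Function.update_eq_self] at h
  exact h
end
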